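/- arXiv:2107.01416 — 2 statements merged into one kernel-verified Lean document; each statement's English description precedes it below -/
import Mathlib

section
/- Let n, c, k be integers with n-1 ≥ c ≥ 2k ≥ 4. The maximum number of edges of a 2-connected graph of order n with circumference c and minimum degree exactly k equals max{f(n,c,k), g(n,c,k)}; that is, every such graph G satisfies e(G) ≤ max{f(n,c,k), g(n,c,k)}, and there exists such a graph attaining this bound. -/
open SimpleGraph

/-- The degree of a vertex, as `Nat.card` of its neighbor set. -/
noncomputable def degN {V : Type*} (G : SimpleGraph V) (v : V) : ℕ :=
  Nat.card (G.neighborSet v)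

/-- `G` has minimum degree exactly `k`. -/
def MinDegreeEq {V : Type*} (G : SimpleGraph V) (k : ℕ) : Prop :=
  (∀ v, k ≤ degN G v) ∧ ∃ v, degN G v = k

/-- `G` is 2-connected: at least 3 vertices and deleting any vertex leaves a connected graph. -/
def TwoConnected {V : Type*} (G : SimpleGraph V) : Prop :=
  3 ≤ Nat.card V ∧ ∀ v : V, (G.induce {u | u ≠ v}).Connected

/-- The circumference of `G`: the length of a longest cycle (0 if there are none). -/
noncomputable def circ {V : Type*} (G : SimpleGraph V) : ℕ :=
  sSup {n | ∃ (v : V) (w : G.Walk v v), w.IsCycle ∧ w.length = n}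

/-- The detour order of `G`: the number of vertices of a longest path. -/
noncomputable def detour {V : Type*} (G : SimpleGraph V) : ℕ :=
  sSup {n | ∃ (u v : V) (p : G.Walk u v), p.IsPath ∧ p.length + 1 = n}

/-- The number of cliques of cardinality `s` in `G`. -/
noncomputable def cliquesN {V : Type*} (G : SimpleGraph V) (s : ℕ) : ℕ :=
  Nat.card {S : Finset V // G.IsNClique s S}

/-- The number of edges of `G`. -/
noncomputable def edgeCount {V : Type*} (G : SimpleGraph V) : ℕ :=
  Nat.card G.edgeSet

/-- `G` contains a Hamilton cycle. -/
def IsHamiltonianGr {V : Type*} (G : SimpleGraph V) : Prop :=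
  ∃ (v : V) (w : G.Walk v v), w.IsCycle ∧ ∀ u : V, u ∈ w.support

/-- `G` contains a Hamilton path. -/
def IsTraceableGr {V : Type*} (G : SimpleGraph V) : Prop :=
  ∃ (u v : V) (p : G.Walk u v), p.IsPath ∧ ∀ w : V, w ∈ p.support

/-- `f_s(n,c,k) = C(c+1-k, s) + (n-c-1+k)·C(k, s-1)`. -/
def fCliques (n c k s : ℕ) : ℕ :=
  Nat.choose (c + 1 - k) s + (n + k - c - 1) * Nat.choose k (s - 1)

/-- `g_s(n,c,k) = C(c+1-t, s) + (n-c-2+t)·C(t, s-1) + C(k, s-1)` with `t = ⌊c/2⌋`. -/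
def gCliques (n c k s : ℕ) : ℕ :=
  Nat.choose (c + 1 - c / 2) s + (n + c / 2 - c - 2) * Nat.choose (c / 2) (s - 1)
    + Nat.choose k (s - 1)

/-- `g_s(n,c,k,q) = q·C(k, s-1) + (n-q-c-1+t)·C(t, s-1) + C(c+1-t, s)` with `t = ⌊c/2⌋`. -/
def gCliquesQ (n c k q s : ℕ) : ℕ :=
  q * Nat.choose k (s - 1) + (n + c / 2 - q - c - 1) * Nat.choose (c / 2) (s - 1)
    + Nat.choose (c + 1 - c / 2) s

/-- `F(n,c,k) = K_k ∨ (K_{c+1-2k} + \overline{K_{n-c-1+k}})`, realized on `Fin n`: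
vertices `0,…,k-1` are the dominating clique `K_k`, vertices `k,…,c-k` extend it to
`K_{c+1-k}`, and vertices `c-k+1,…,n-1` form the independent part. -/
def Fgraph (n c k : ℕ) : SimpleGraph (Fin n) where
  Adj x y := x ≠ y ∧ (x.val < k ∨ y.val < k ∨ (x.val ≤ c - k ∧ y.val ≤ c - k))
  symm := by constructor; intro x y h; exact ⟨h.1.symm, by tauto⟩
  loopless := by constructor; intro x h; exact h.1 rfl

/-- `G(n,c,k)`: from `K_t ∨ (K_{c+1-2t} + \overline{K_{n-c-1+t}})` (with `t = ⌊c/2⌋`)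
delete `t-k` edges incident to one common vertex (the vertex `n-1`) of the independent
part, keeping only its `k` neighbors `0,…,k-1`. -/
def Ggraph (n c k : ℕ) : SimpleGraph (Fin n) :=
  (Fgraph n c (c / 2)).deleteEdges
    {e | ∃ x y : Fin n, e = s(x, y) ∧ x.val = n - 1 ∧ k ≤ y.val ∧ y.val < c / 2}


/-- `PathOn G x y S`: there is a path from `x` to `y` with vertex set exactly `S`. -/
inductive PathOn {V : Type*} [DecidableEq V] (G : SimpleGraph V) : V → V → Finset V → Prop
  | single (x : V) : PathOn G x x {x}
  | cons {x y z : V} {S : Finset V} : G.Adj x y → PathOn G y z S → x ∉ S →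
      PathOn G x z (insert x S)

namespace PathOn
variable {V : Type*} [DecidableEq V] {G : SimpleGraph V}

lemma left_mem {x y : V} {S : Finset V} (h : PathOn G x y S) : x ∈ S := by
  cases h <;> simp

lemma right_mem {x y : V} {S : Finset V} (h : PathOn G x y S) : y ∈ S := by
  induction h with
  | single => simp
  | cons _ _ _ ih => simp [ih]

lemma mono {G' : SimpleGraph V} (hG : G ≤ G') {x y : V} {S : Finset V} (h : PathOn G x y S) :
    PathOn G' x y S := by
  induction h with
  | single x => exact .single x
  | cons a _ c ih => exact .cons (hG a) ih c

lemma append {x y z w : V} {S T : Finset V} (h : PathOn G x y S) (h' : PathOn G z w T)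
    (ha : G.Adj y z) (hd : Disjoint S T) : PathOn G x w (S ∪ T) := by
  induction h with
  | single x =>
    have := PathOn.cons ha h' (by simpa using hd)
    rwa [Finset.insert_eq] at this
  | @cons x y' y S a p c ih =>
    rw [Finset.disjoint_insert_left] at hd
    have := PathOn.cons a (ih ha hd.2) (by simp [c, hd.1])
    rwa [Finset.insert_union]

lemma snoc {x y z : V} {S : Finset V} (h : PathOn G x y S) (ha : G.Adj y z) (hz : z ∉ S) :
    PathOn G x z (insert z S) := by
  have := h.append (.single z) ha (by simpa using hz)
  rwa [Finset.union_comm, ← Finset.insert_eq] at this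

lemma reverse {x y : V} {S : Finset V} (h : PathOn G x y S) : PathOn G y x S := by
  induction h with
  | single x => exact .single x
  | cons a _ c ih => exact ih.snoc a.symm c

lemma eq_single {x : V} {S : Finset V} (h : PathOn G x x S) : S = {x} := by
  cases h with
  | single => rfl
  | cons a p c => exact absurd p.right_mem c

lemma tail {x y : V} {S : Finset V} (h : PathOn G x y S) (hxy : x ≠ y) :
    ∃ x', G.Adj x x' ∧ PathOn G x' y (S.erase x) := by
  cases h with
  | single => exact absurd rfl hxy
  | @cons _ x' _ S a p c => exact ⟨x', a, by rwa [Finset.erase_insert c]⟩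

/-- gluing two paths at a common endpoint -/
lemma glue {x y z : V} {S T : Finset V} (h : PathOn G x y S) (h' : PathOn G y z T)
    (hd : ∀ w ∈ S, w ∈ T → w = y) : PathOn G x z (S ∪ T) := by
  by_cases hyz : y = z
  · subst hyz
    rw [h'.eq_single]
    rwa [Finset.union_eq_left.2 (by simpa using h.right_mem)]
  · obtain ⟨y', a, p⟩ := h'.tail hyz
    have := h.append p a (by
      rw [Finset.disjoint_left]; intro w hw hw'
      rw [Finset.mem_erase] at hw'
      exact hw'.1 (hd w hw hw'.2))
    have e : S ∪ T.erase y = S ∪ T := by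
      ext w; simp only [Finset.mem_union, Finset.mem_erase]
      constructor
      · tauto
      · have := h.right_mem
        by_cases hw : w = y <;> simp_all
    rwa [e] at this

/-- first hit of a set -/
lemma first_hit {x y : V} {S : Finset V} (h : PathOn G x y S) (B : Set V) (hy : y ∈ B) :
    ∃ z ∈ B, ∃ S' ⊆ S, PathOn G x z S' ∧ ∀ w ∈ S', w ∈ B → w = z := by
  induction h with
  | single x => exact ⟨x, hy, {x}, subset_rfl, .single x, by simp⟩
  | @cons x x' y S a p c ih =>
    by_cases hx : x ∈ B
    · exact ⟨x, hx, {x}, by simp, .single x, by simp⟩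
    · obtain ⟨z, hz, S', hS', p', hh⟩ := ih hy
      refine ⟨z, hz, insert x S', Finset.insert_subset_insert _ hS', .cons a p' (fun h => c (hS' h)), ?_⟩
      intro w hw hwB
      rcases Finset.mem_insert.1 hw with rfl | hw
      · exact absurd hwB hx
      · exact hh w hw hwB

lemma trim {x y : V} {S : Finset V} (h : PathOn G x y S) (A B : Set V) (hx : x ∈ A) (hy : y ∈ B) :
    ∃ x' ∈ A, ∃ y' ∈ B, ∃ S' ⊆ S, PathOn G x' y' S' ∧ (∀ w ∈ S', w ∈ A → w = x') ∧
      ∀ w ∈ S', w ∈ B → w = y' := by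
  obtain ⟨y', hy', S1, hS1, p1, h1⟩ := h.first_hit B hy
  obtain ⟨x', hx', S2, hS2, p2, h2⟩ := p1.reverse.first_hit A hx
  exact ⟨x', hx', y', hy', S2, hS2.trans hS1, p2.reverse, h2, fun w hw hB => h1 w (hS2 hw) hB⟩

/-- initial piece of a path -/
lemma initial {x y z : V} {S : Finset V} (h : PathOn G x y S) (hz : z ∈ S) :
    ∃ S' ⊆ S, PathOn G x z S' ∧ (z ≠ y → y ∉ S') := by
  induction h with
  | single x =>
    obtain rfl : z = x := by simpa using hz
    exact ⟨{z}, subset_rfl, .single z, by simp⟩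
  | @cons x x' y S a p c ih =>
    by_cases hzx : z = x
    · subst hzx
      exact ⟨{z}, by simp, .single z, by simp; tauto⟩
    · obtain ⟨S', hS', p', hh⟩ := ih (by simpa [hzx] using hz)
      refine ⟨insert x S', Finset.insert_subset_insert _ hS', .cons a p' (fun h => c (hS' h)), ?_⟩
      intro hzy
      have : y ≠ x := by rintro rfl; exact c p.right_mem
      simp [this, hh hzy]

lemma of_walk {x y : V} (w : G.Walk x y) (hw : w.IsPath) : PathOn G x y w.support.toFinset := by
  induction w with
  | nil => simpa using PathOn.single _
  | cons a p ih =>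
    rw [Walk.cons_isPath_iff] at hw
    simpa using PathOn.cons a (ih hw.1) (by simpa using hw.2)

lemma to_walk {x y : V} {S : Finset V} (h : PathOn G x y S) :
    ∃ w : G.Walk x y, w.IsPath ∧ w.support.toFinset = S := by
  induction h with
  | single x => exact ⟨.nil, by simp, by simp⟩
  | cons a p c ih =>
    obtain ⟨w, hw, hs⟩ := ih
    refine ⟨.cons a w, ?_, by simp [hs]⟩
    rw [Walk.cons_isPath_iff]
    exact ⟨hw, fun h => c (by rw [← hs]; simpa using h)⟩

/-- indexing a path -/
lemma index {x y : V} {S : Finset V} (h : PathOn G x y S) :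
    ∃ (p : ℕ → V) (L : ℕ), p 0 = x ∧ p L = y ∧ S.card = L + 1 ∧
      (∀ i < L, G.Adj (p i) (p (i + 1))) ∧
      (∀ i ≤ L, ∀ j ≤ L, p i = p j → i = j) ∧ (∀ z, z ∈ S ↔ ∃ i ≤ L, p i = z) := by
  induction h with
  | single x => exact ⟨fun _ => x, 0, by simp [eq_comm]⟩
  | @cons x x' y S a q c ih =>
    obtain ⟨p, L, h0, hL, hc, hadj, hinj, hmem⟩ := ih
    refine ⟨fun i => Nat.casesOn i x p, L + 1, rfl, hL, by rw [Finset.card_insert_of_notMem c, hc],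
      ?_, ?_, ?_⟩
    · rintro (_ | i) hi
      · simpa [h0] using a
      · exact hadj i (by omega)
    · rintro (_ | i) hi (_ | j) hj hij
      · rfl
      · exact absurd ((hmem x).2 ⟨j, by omega, hij.symm⟩) c
      · exact absurd ((hmem x).2 ⟨i, by omega, hij⟩) c
      · rw [hinj i (by omega) j (by omega) hij]
    · intro z
      rw [Finset.mem_insert, hmem]
      constructor
      · rintro (rfl | ⟨i, hi, rfl⟩)
        · exact ⟨0, by omega, rfl⟩
        · exact ⟨i + 1, by omega, rfl⟩
      · rintro ⟨_ | i, hi, h⟩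
        · exact Or.inl h.symm
        · exact Or.inr ⟨i, by omega, h⟩

/-- segments of an indexed path -/
lemma segment {p : ℕ → V} {L : ℕ} (hadj : ∀ i < L, G.Adj (p i) (p (i + 1)))
    (hinj : ∀ i ≤ L, ∀ j ≤ L, p i = p j → i = j) (i d : ℕ) (hd : i + d ≤ L) :
    PathOn G (p i) (p (i + d)) ((Finset.Icc i (i + d)).image p) := by
  induction d with
  | zero => simpa using PathOn.single (p i)
  | succ d ih =>
    have := (ih (by omega)).snoc (hadj (i + d) (by omega)) (by
      simp only [Finset.mem_image, Finset.mem_Icc, not_exists, not_and]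
      intro j hj h
      have := hinj j (by omega) (i + d + 1) (by omega) h
      omega)
    rw [← Finset.image_insert] at this
    have e : Finset.Icc i (i + (d + 1)) = insert (i + d + 1) (Finset.Icc i (i + d)) := by
      ext j; simp only [Finset.mem_Icc, Finset.mem_insert]; omega
    rw [e]
    exact this

lemma segment' {p : ℕ → V} {L : ℕ} (hadj : ∀ i < L, G.Adj (p i) (p (i + 1)))
    (hinj : ∀ i ≤ L, ∀ j ≤ L, p i = p j → i = j) (i j : ℕ) (hij : i ≤ j) (hj : j ≤ L) :
    PathOn G (p i) (p j) ((Finset.Icc i j).image p) := by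
  obtain ⟨d, rfl⟩ := Nat.exists_eq_add_of_le hij
  exact segment hadj hinj i d hj

end PathOn

/-- `G` has a cycle with exactly `N` vertices. -/
def HasCyc {V : Type*} [DecidableEq V] (G : SimpleGraph V) (N : ℕ) : Prop :=
  3 ≤ N ∧ ∃ x y S, PathOn G x y S ∧ G.Adj y x ∧ S.card = N

section
variable {V : Type*} [DecidableEq V] {G : SimpleGraph V}

lemma hasCyc_of_two {u w : V} {S T : Finset V} (h1 : PathOn G u w S) (h2 : PathOn G u w T)
    (huw : u ≠ w) (hST : ∀ z ∈ S, z ∈ T → z = u ∨ z = w) (h3 : 3 ≤ (S ∪ T).card) :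
    HasCyc G (S ∪ T).card := by
  obtain ⟨u', a, p⟩ := h2.tail huw
  have := h1.glue p.reverse (by
    intro z hz hz'
    rw [Finset.mem_erase] at hz'
    rcases hST z hz hz'.2 with h | h
    · exact absurd h hz'.1
    · exact h)
  have e : S ∪ T.erase u = S ∪ T := by
    ext w; simp only [Finset.mem_union, Finset.mem_erase]
    constructor
    · tauto
    · have := h1.left_mem
      by_cases hw : w = u <;> simp_all
  rw [e] at this
  exact ⟨h3, _, _, _, this, a.symm, rfl⟩

/-- a connectivity condition equivalent to 2-connectedness -/
def Conn2 (G : SimpleGraph V) : Prop :=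
  ∀ v x y, x ≠ v → y ≠ v → ∃ S, v ∉ S ∧ PathOn G x y S

lemma two_paths (hG : Conn2 G) {p : ℕ → V} {L : ℕ} (hadj : ∀ i < L, G.Adj (p i) (p (i + 1)))
    (hinj : ∀ i ≤ L, ∀ j ≤ L, p i = p j → i = j) (a : ℕ) (ha : 1 ≤ a) (d : ℕ) (hd : a + d < L) :
    ∃ u w l S T, PathOn G (p u) (p (a + d)) S ∧ PathOn G (p w) (p l) T ∧ Disjoint S T ∧
      ((u = a ∧ w < a) ∨ (w = a ∧ u < a)) ∧ a + d < l ∧ l ≤ L ∧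
      (∀ s ≤ L, p s ∈ S → (s ≤ a → s = u) ∧ (a + d ≤ s → s = a + d)) ∧
      (∀ s ≤ L, p s ∈ T → (s ≤ a → s = w) ∧ (a + d ≤ s → s = l)) := by
  induction d with
  | zero =>
    obtain ⟨S0, hS0, p0⟩ := hG (p a) (p 0) (p L)
      (fun h => by have := hinj _ (by omega) _ (by omega) h; omega)
      (fun h => by have := hinj _ (by omega) _ (by omega) h; omega)
    obtain ⟨_, ⟨w, hw, rfl⟩, _, ⟨l, ⟨hl, hl'⟩, rfl⟩, T, hT, q, hA, hB⟩ :=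
      p0.trim {z | ∃ s < a, p s = z} {z | ∃ s, (a < s ∧ s ≤ L) ∧ p s = z} ⟨0, by omega, rfl⟩
        ⟨L, by omega, rfl⟩
    have haT : p a ∉ T := fun h => hS0 (hT h)
    refine ⟨a, w, l, {p a}, T, .single _, q, by simpa using haT, by omega, by omega, by omega, ?_, ?_⟩
    · intro s hs h
      have := hinj s hs a (by omega) (by simpa using h)
      omega
    · intro s hs h
      have hsa : s ≠ a := by rintro rfl; exact haT h
      refine ⟨fun h' => ?_, fun h' => ?_⟩
      · exact hinj _ hs _ (by omega) (hA _ h ⟨s, by omega, rfl⟩)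
      · exact hinj _ hs _ (by omega) (hB _ h ⟨s, by omega, rfl⟩)
  | succ d ih =>
    obtain ⟨u, w, l, S, T, hS, hT, hST, huw, hl, hlL, cS, cT⟩ := ih (by omega)
    rw [Finset.disjoint_left] at hST
    have hstep := hadj (a + d) (by omega)
    have hnS : p (a + d + 1) ∉ S := fun h => by
      have := (cS _ (by omega) h).2 (by omega); omega
    have hS1 := hS.snoc hstep hnS
    rw [← add_assoc]
    -- conditions for the extended first path
    have cS1 : ∀ s ≤ L, p s ∈ insert (p (a + d + 1)) S →
        (s ≤ a → s = u) ∧ (a + d + 1 ≤ s → s = a + d + 1) := by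
      intro s hs h
      rcases Finset.mem_insert.1 h with h | h
      · have := hinj _ hs _ (by omega) h; omega
      · have := cS s hs h; omega
    by_cases hl1 : l = a + d + 1
    · subst hl1
      obtain ⟨S0, hS0, p0⟩ := hG (p (a + d + 1)) (p a) (p L)
        (fun h => by have := hinj _ (by omega) _ (by omega) h; omega)
        (fun h => by have := hinj _ (by omega) _ (by omega) h; omega)
      obtain ⟨z, ⟨hz1, hz⟩, _, ⟨l', ⟨hl', hl'L⟩, rfl⟩, R, hR, hRp, hA, hB⟩ :=
        p0.trim {z | z ≠ p (a + d + 1) ∧ ((∃ s ≤ a, p s = z) ∨ z ∈ S ∨ z ∈ T)}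
          {z | ∃ s, (a + d + 1 < s ∧ s ≤ L) ∧ p s = z}
          ⟨fun h => by have := hinj _ (by omega) _ (by omega) h; omega, Or.inl ⟨a, le_rfl, rfl⟩⟩
          ⟨L, by omega, rfl⟩
      have hnR : p (a + d + 1) ∉ R := fun h => hS0 (hR h)
      have hRS : ∀ x ∈ R, x ∈ S → x = z := fun x hx hxS =>
        hA x hx ⟨fun h => hnR (h ▸ hx), Or.inr (Or.inl hxS)⟩
      have hRT : ∀ x ∈ R, x ∈ T → x = z := fun x hx hxS =>
        hA x hx ⟨fun h => hnR (h ▸ hx), Or.inr (Or.inr hxS)⟩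
      have hRa : ∀ s ≤ a, p s ∈ R → p s = z := fun s hs hx =>
        hA _ hx ⟨fun h => hnR (h ▸ hx), Or.inl ⟨s, hs, rfl⟩⟩
      have hRb : ∀ s ≤ L, a + d + 1 ≤ s → p s ∈ R → s = l' := fun s hs hs' hx => by
        have : s ≠ a + d + 1 := by rintro rfl; exact hnR hx
        exact hinj _ hs _ (by omega) (hB _ hx ⟨s, by omega, rfl⟩)
      by_cases hzS : z ∈ S
      · obtain ⟨S', hS'S, q, -⟩ := hS.initial hzS
        have q' := q.glue hRp (fun x hx hxR => hRS x hxR (hS'S hx))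
        refine ⟨w, u, l', T, S' ∪ R, hT, q', ?_, by tauto, by omega, hl'L, ?_, ?_⟩
        · rw [Finset.disjoint_left]
          intro x hx hx'
          rcases Finset.mem_union.1 hx' with h | h
          · exact hST (hS'S h) hx
          · have := hRT x h hx
            subst this
            exact hST hzS hx
        · intro s hs h
          have := cT s hs h; omega
        · intro s hs h
          rcases Finset.mem_union.1 h with h | h
          · have := cS s hs (hS'S h); 
            refine ⟨this.1, fun h' => ?_⟩
            omega
          · refine ⟨fun h' => ?_, fun h' => hRb s hs h' h⟩
            have e := hRa s h' h
            exact (cS s hs (e ▸ hzS)).1 h'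
      by_cases hzT : z ∈ T
      · obtain ⟨T', hT'T, q, hne⟩ := hT.initial hzT
        have hne := hne hz1
        have q' := q.glue hRp (fun x hx hxR => hRT x hxR (hT'T hx))
        refine ⟨u, w, l', _, T' ∪ R, hS1, q', ?_, huw, by omega, hl'L, cS1, ?_⟩
        · rw [Finset.disjoint_left]
          intro x hx hx'
          rcases Finset.mem_insert.1 hx with rfl | hx
          · simp [hne, hnR] at hx'
          rcases Finset.mem_union.1 hx' with h | h
          · exact hST hx (hT'T h)
          · have := hRS x h hx
            subst this
            exact hzS hx
        · intro s hs h
          rcases Finset.mem_union.1 h with h | h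
          · have := cT s hs (hT'T h)
            refine ⟨this.1, fun h' => ?_⟩
            have := this.2 (by omega)
            subst this
            exact absurd h hne
          · refine ⟨fun h' => ?_, fun h' => hRb s hs h' h⟩
            have e := hRa s h' h
            exact (cT s hs (e ▸ hzT)).1 h'
      · obtain ⟨s0, hs0, rfl⟩ : ∃ s ≤ a, p s = z := by tauto
        have hs0a : s0 ≠ a := by
          rintro rfl
          rcases huw with ⟨rfl, -⟩ | ⟨rfl, -⟩
          · exact hzS hS.left_mem
          · exact hzT hT.left_mem
        have cR : ∀ s ≤ L, p s ∈ R → (s ≤ a → s = s0) ∧ (a + d + 1 ≤ s → s = l') := by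
          intro s hs h
          exact ⟨fun h' => hinj _ hs _ (by omega) (hRa s h' h), fun h' => hRb s hs h' h⟩
        rcases huw with ⟨rfl, hw⟩ | ⟨rfl, hu⟩
        · refine ⟨u, s0, l', _, R, hS1, hRp, ?_, by omega, by omega, hl'L, cS1, cR⟩
          rw [Finset.disjoint_left]
          intro x hx hx'
          rcases Finset.mem_insert.1 hx with rfl | hx
          · exact hnR hx'
          · exact hzS (hRS x hx' hx ▸ hx)
        · refine ⟨w, s0, l', T, R, hT, hRp, ?_, by omega, by omega, hl'L, ?_, cR⟩
          · rw [Finset.disjoint_left]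
            intro x hx hx'
            exact hzT (hRT x hx' hx ▸ hx)
          · intro s hs h
            have := cT s hs h; omega
    · refine ⟨u, w, l, _, T, hS1, hT, ?_, huw, by omega, hlL, cS1, ?_⟩
      · rw [Finset.disjoint_left]
        intro x hx hx'
        rcases Finset.mem_insert.1 hx with rfl | hx
        · have := (cT _ (by omega) hx').2 (by omega)
          omega
        · exact hST hx hx'
      · intro s hs h
        have := cT s hs h; omega


open Finset in
lemma kopylov (hG : Conn2 G) {p : ℕ → V} {L : ℕ} (hadj : ∀ i < L, G.Adj (p i) (p (i + 1)))
    (hinj : ∀ i ≤ L, ∀ j ≤ L, p i = p j → i = j) (hL : 2 ≤ L) (hn : ¬ G.Adj (p 0) (p L))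
    (X Y : Finset ℕ) (hX : ∀ i, i ∈ X ↔ i ≤ L ∧ G.Adj (p 0) (p i))
    (hY : ∀ i, i ∈ Y ↔ i ≤ L ∧ G.Adj (p L) (p i)) (N : ℕ) (h3 : 3 ≤ N) (hNL : N ≤ L + 1)
    (hN : N ≤ X.card + Y.card) : ∃ C, N ≤ C ∧ HasCyc G C := by
  have hX0 : 0 ∉ X := fun h => G.irrefl ((hX 0).1 h).2
  have hXL : L ∉ X := fun h => hn ((hX L).1 h).2
  have hY0 : 0 ∉ Y := fun h => hn ((hY 0).1 h).2.symm
  have hYL : L ∉ Y := fun h => G.irrefl ((hY L).1 h).2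
  have hX1 : 1 ∈ X := (hX 1).2 ⟨by omega, hadj 0 (by omega)⟩
  have hYm : L - 1 ∈ Y := (hY _).2 ⟨by omega, by
    have := hadj (L - 1) (by omega)
    rw [show L - 1 + 1 = L by omega] at this
    exact this.symm⟩
  have hXle : ∀ i ∈ X, 1 ≤ i ∧ i < L := fun i hi => by
    have h1 : i ≠ 0 := by rintro rfl; exact hX0 hi
    have h2 : i ≠ L := by rintro rfl; exact hXL hi
    have := ((hX i).1 hi).1
    omega
  have hYle : ∀ i ∈ Y, 1 ≤ i ∧ i < L := fun i hi => by
    have h1 : i ≠ 0 := by rintro rfl; exact hY0 hi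
    have h2 : i ≠ L := by rintro rfl; exact hYL hi
    have := ((hY i).1 hi).1
    omega
  have hcardimg : ∀ I : Finset ℕ, (∀ i ∈ I, i ≤ L) → (I.image p).card = I.card := by
    intro I hI
    exact Finset.card_image_of_injOn (fun i hi j hj h => hinj i (hI i hi) j (hI j hj) h)
  by_cases hcr : ∃ d i, i ∈ Y ∧ i + d + 1 ∈ X
  · classical
    obtain ⟨i, hi, hj⟩ := Nat.find_spec hcr
    have hmin : ∀ d' < Nat.find hcr, ∀ i, i ∈ Y → i + d' + 1 ∉ X := by
      intro d' hd' i hi h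
      exact Nat.find_min hcr hd' ⟨i, hi, h⟩
    generalize Nat.find hcr = d at hj hmin
    have bi := hYle i hi
    have bj := hXle _ hj
    have s1 := PathOn.segment' hadj hinj 0 i (by omega) (by omega)
    have s2 := (PathOn.segment' hadj hinj (i + d + 1) L (by omega) (by omega)).reverse
    have s3 := s1.append s2 ((hY i).1 hi).2.symm (by
      rw [Finset.disjoint_left]
      simp only [mem_image, mem_Icc]
      rintro x ⟨s, hs, rfl⟩ ⟨s', hs', h⟩
      have := hinj _ (by omega) _ (by omega) h
      omega)
    rw [← Finset.image_union] at s3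
    have hcard : (image p (Icc 0 i ∪ Icc (i + d + 1) L)).card = L + 1 - d := by
      rw [hcardimg, card_union_of_disjoint]
      · simp; omega
      · rw [Finset.disjoint_left]; simp only [mem_Icc]; omega
      · simp only [mem_union, mem_Icc]; omega
    have hNd : N ≤ L + 1 - d := by
      rcases Nat.eq_zero_or_pos d with rfl | hd
      · simpa using hNL
      have hdis : Disjoint X (Y.image (· + 1)) := by
        rw [Finset.disjoint_left]
        intro x hx hx'
        obtain ⟨y, hy, rfl⟩ := Finset.mem_image.1 hx'
        exact hmin 0 hd y hy (by simpa using hx)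
      have hsub : X ∪ Y.image (· + 1) ⊆ Icc 1 (i + 1) ∪ Icc (i + d + 1) L := by
        intro x hx
        simp only [mem_union, mem_Icc]
        rcases Finset.mem_union.1 hx with hx | hx
        · have := hXle x hx
          by_contra hcon
          exact hmin (x - i - 1) (by omega) i hi (by
            rwa [show i + (x - i - 1) + 1 = x by omega])
        · obtain ⟨y, hy, rfl⟩ := Finset.mem_image.1 hx
          have := hYle y hy
          by_contra hcon
          exact hmin (i + d - y) (by omega) y hy (by
            rwa [show y + (i + d - y) + 1 = i + d + 1 by omega])
      have := card_le_card hsub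
      rw [card_union_of_disjoint hdis, card_image_of_injective _ (add_left_injective 1)] at this
      have := this.trans (card_union_le _ _)
      simp at this
      omega
    refine ⟨L + 1 - d, hNd, by omega, _, _, _, s3, ((hX _).1 hj).2.symm, hcard⟩
  · have hnc : ∀ i ∈ Y, ∀ j ∈ X, j ≤ i := by
      intro i hi j hj
      by_contra h
      exact hcr ⟨j - i - 1, i, hi, by rwa [show i + (j - i - 1) + 1 = j by omega]⟩
    have hXne : X.Nonempty := ⟨1, hX1⟩
    have hYne : Y.Nonempty := ⟨_, hYm⟩
    obtain ⟨a, haX, hamax⟩ : ∃ a ∈ X, ∀ x ∈ X, x ≤ a := ⟨X.max' hXne, X.max'_mem _, fun x hx => X.le_max' x hx⟩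
    obtain ⟨b, hbY, hbmin⟩ : ∃ b ∈ Y, ∀ y ∈ Y, b ≤ y := ⟨Y.min' hYne, Y.min'_mem _, fun x hx => Y.min'_le x hx⟩
    have hab := hnc b hbY a haX
    have ba := hXle a haX
    have bb := hYle b hbY
    obtain ⟨u, w, l, S, T, hS, hT, hST, huw, hl, hlL, cS, cT⟩ :=
      two_paths hG hadj hinj a ba.1 (b - a) (by omega)
    rw [show a + (b - a) = b by omega] at hS hl cS cT
    rw [Finset.disjoint_left] at hST
    -- the path on the left side
    have left : ∀ q < a, ∃ I : Finset ℕ, X ⊆ I ∧ 0 ∈ I ∧ (∀ i ∈ I, i ≤ a) ∧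
        PathOn G (p q) (p a) (I.image p) := by
      intro q hq
      obtain ⟨s, hs, hsmin⟩ : ∃ s ∈ X.filter (q < ·), ∀ x ∈ X.filter (q < ·), s ≤ x :=
        ⟨_, Finset.min'_mem _ ⟨a, by simp [haX, hq]⟩, fun x hx => Finset.min'_le _ x hx⟩
      rw [mem_filter] at hs
      have hsa := hamax s hs.1
      have s1 := (PathOn.segment' hadj hinj 0 q (by omega) (by omega)).reverse
      have s2 := PathOn.segment' hadj hinj s a (by omega) (by omega)
      have s3 := s1.append s2 ((hX s).1 hs.1).2 (by
        rw [Finset.disjoint_left]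
        simp only [mem_image, mem_Icc]
        rintro x ⟨s, hs, rfl⟩ ⟨s', hs', h⟩
        have := hinj _ (by omega) _ (by omega) h
        omega)
      rw [← Finset.image_union] at s3
      refine ⟨_, ?_, by simp, by simp only [mem_union, mem_Icc]; omega, s3⟩
      intro x hx
      simp only [mem_union, mem_Icc]
      have := hamax x hx
      by_cases hxq : q < x
      · have := hsmin x (by simp [hx, hxq]); omega
      · omega
    have right : ∃ I : Finset ℕ, Y ⊆ I ∧ (∀ i ∈ I, b ≤ i ∧ i ≤ L) ∧
        PathOn G (p b) (p l) (I.image p) := by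
      obtain ⟨s, hs, hsmax⟩ : ∃ s ∈ Y.filter (· < l), ∀ x ∈ Y.filter (· < l), x ≤ s :=
        ⟨_, Finset.max'_mem _ ⟨b, by simp [hbY, hl]⟩, fun x hx => Finset.le_max' _ x hx⟩
      rw [mem_filter] at hs
      have hsb := hbmin s hs.1
      have s1 := PathOn.segment' hadj hinj b s (by omega) (by omega)
      have s2 := (PathOn.segment' hadj hinj l L (by omega) (by omega)).reverse
      have s3 := s1.append s2 ((hY s).1 hs.1).2.symm (by
        rw [Finset.disjoint_left]
        simp only [mem_image, mem_Icc]
        rintro x ⟨s, hs, rfl⟩ ⟨s', hs', h⟩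
        have := hinj _ (by omega) _ (by omega) h
        omega)
      rw [← Finset.image_union] at s3
      refine ⟨_, ?_, by simp only [mem_union, mem_Icc]; omega, s3⟩
      intro x hx
      simp only [mem_union, mem_Icc]
      have := hbmin x hx
      have := hYle x hx
      by_cases hxq : x < l
      · have := hsmax x (by simp [hx, hxq]); omega
      · omega
    obtain ⟨J, hJY, hJ, pJ⟩ := right
    have count : ∀ I : Finset ℕ, X ⊆ I → 0 ∈ I → (∀ i ∈ I, i ≤ a) → 
        N ≤ (I.image p ∪ J.image p).card := by
      intro I hXI h0 hI
      rw [← image_union, hcardimg]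
      · have h1 : (X.erase a ∪ insert 0 Y) ⊆ I ∪ J := by
          intro x hx
          simp only [mem_union, mem_erase, mem_insert] at hx ⊢
          rcases hx with hx | rfl | hx
          · exact Or.inl (hXI hx.2)
          · exact Or.inl h0
          · exact Or.inr (hJY hx)
        have h2 := card_le_card h1
        rw [card_union_of_disjoint, card_erase_of_mem haX, card_insert_of_notMem hY0] at h2
        · have := card_pos.2 hXne
          omega
        · rw [Finset.disjoint_left]
          intro x hx hx'
          simp only [mem_erase, mem_insert] at hx hx'
          rcases hx' with rfl | hx'
          · exact hX0 hx.2
          · have := hnc x hx' a haX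
            have := hamax x hx.2
            omega
      · intro i hi
        rcases mem_union.1 hi with hi | hi
        · have := hI i hi; omega
        · exact (hJ i hi).2
    have hpl : ∀ I : Finset ℕ, (∀ i ∈ I, i ≤ L) → ∀ s ≤ L, p s ∈ I.image p → s ∈ I := by
      intro I hI s hs h
      obtain ⟨i, hi, e⟩ := mem_image.1 h
      rwa [← hinj i (hI i hi) s hs e]
    rcases huw with ⟨rfl, hw⟩ | ⟨rfl, hu⟩
    · obtain ⟨I, hXI, h0I, hI, pI⟩ := left w hw
      have hc := count I hXI h0I hI
      have g1 := pI.glue hS (by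
        intro x hx hxS
        obtain ⟨i, hi, rfl⟩ := mem_image.1 hx
        rw [(cS i (by have := hI i hi; omega) hxS).1 (hI i hi)])
      have g2 := g1.glue pJ (by
        intro x hx hxJ
        obtain ⟨j, hj, rfl⟩ := mem_image.1 hxJ
        have bj := hJ j hj
        rcases mem_union.1 hx with h | h
        · have := hI j (hpl I (fun i hi => by have := hI i hi; omega) j bj.2 h)
          rw [show j = b by omega]
        · rw [(cS j bj.2 h).2 bj.1])
      have hle : N ≤ (image p I ∪ S ∪ image p J ∪ T).card :=
        hc.trans (card_le_card (by intro x; simp only [mem_union]; tauto))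
      refine ⟨_, hle, hasCyc_of_two g2 hT ?_ ?_ (by omega)⟩
      · intro h; have := hinj _ (by omega) _ (by omega) h; omega
      · intro z hz hzT
        rcases mem_union.1 hz with hz | hz
        rcases mem_union.1 hz with hz | hz
        · obtain ⟨i, hi, rfl⟩ := mem_image.1 hz
          left; rw [(cT i (by have := hI i hi; omega) hzT).1 (hI i hi)]
        · exact absurd hzT (hST hz)
        · obtain ⟨j, hj, rfl⟩ := mem_image.1 hz
          right; rw [(cT j (hJ j hj).2 hzT).2 (hJ j hj).1]
    · obtain ⟨I, hXI, h0I, hI, pI⟩ := left u hu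
      have hc := count I hXI h0I hI
      have g1 := pI.glue hT (by
        intro x hx hxS
        obtain ⟨i, hi, rfl⟩ := mem_image.1 hx
        rw [(cT i (by have := hI i hi; omega) hxS).1 (hI i hi)])
      have hbT : p b ∉ T := fun h => hST hS.right_mem h
      have haS : p w ∉ S := fun h => hST h hT.left_mem
      have hwb : w ≠ b := by rintro rfl; exact hbT hT.left_mem
      have g2 := g1.glue pJ.reverse (by
        intro x hx hxJ
        obtain ⟨j, hj, rfl⟩ := mem_image.1 hxJ
        have bj := hJ j hj
        rcases mem_union.1 hx with h | h
        · have := hI j (hpl I (fun i hi => by have := hI i hi; omega) j bj.2 h)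
          omega
        · rw [(cT j bj.2 h).2 bj.1])
      have hle : N ≤ (image p I ∪ T ∪ image p J ∪ S).card :=
        hc.trans (card_le_card (by intro x; simp only [mem_union]; tauto))
      refine ⟨_, hle, hasCyc_of_two g2 hS ?_ ?_ (by omega)⟩
      · intro h; have := hinj _ (by omega) _ (by omega) h; omega
      · intro z hz hzT
        rcases mem_union.1 hz with hz | hz
        rcases mem_union.1 hz with hz | hz
        · obtain ⟨i, hi, rfl⟩ := mem_image.1 hz
          left; rw [(cS i (by have := hI i hi; omega) hzT).1 (hI i hi)]
        · exact absurd hz (hST hzT)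
        · obtain ⟨j, hj, rfl⟩ := mem_image.1 hz
          right; rw [(cS j (hJ j hj).2 hzT).2 (hJ j hj).1]


open Finset in
lemma kopylov_set (hG : Conn2 G) {x y : V} {S : Finset V} (hp : PathOn G x y S)
    (hn : ¬ G.Adj x y) {X Y : Finset V} (hXS : X ⊆ S) (hYS : Y ⊆ S) (hX : ∀ z ∈ X, G.Adj x z)
    (hY : ∀ z ∈ Y, G.Adj y z) {N : ℕ} (h3 : 3 ≤ N) (hNS : N ≤ S.card)
    (hN : N ≤ X.card + Y.card) : ∃ C, N ≤ C ∧ HasCyc G C := by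
  classical
  obtain ⟨p, L, h0, hL, hc, hadj, hinj, hmem⟩ := hp.index
  subst h0 hL
  have key : ∀ (v : V) (Z : Finset V), Z ⊆ S → (∀ z ∈ Z, G.Adj v z) →
      Z.card ≤ ((range (L + 1)).filter (fun i => G.Adj v (p i))).card := by
    intro v Z hZ hZa
    refine le_trans (card_le_card (t := ((range (L + 1)).filter (fun i => G.Adj v (p i))).image p) ?_)
      card_image_le
    intro z hz
    obtain ⟨i, hi, rfl⟩ := (hmem z).1 (hZ hz)
    exact mem_image_of_mem _ (by simp [hZa _ hz]; omega)
  have k1 := key _ X hXS hX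
  have k2 := key _ Y hYS hY
  exact kopylov hG hadj hinj (by omega) hn
    ((range (L + 1)).filter (fun i => G.Adj (p 0) (p i)))
    ((range (L + 1)).filter (fun i => G.Adj (p L) (p i)))
    (by intro i; simp) (by intro i; simp)
    N h3 (by omega) (hN.trans (by gcongr))

/-- splitting a path of `G + xy` -/
lemma split_edge {x y : V} {a b : V} {S : Finset V} (h : PathOn (G ⊔ edge x y) a b S) :
    PathOn G a b S ∨ ∃ S1 S2, Disjoint S1 S2 ∧ S = S1 ∪ S2 ∧
      ((PathOn G a x S1 ∧ PathOn G y b S2) ∨ (PathOn G a y S1 ∧ PathOn G x b S2)) := by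
  induction h with
  | single a => exact Or.inl (.single a)
  | @cons a a' b S ha p c ih =>
    rw [sup_adj, edge_adj] at ha
    by_cases hGa : G.Adj a a'
    · rcases ih with ih | ⟨S1, S2, hd, rfl, ih⟩
      · exact Or.inl (.cons hGa ih c)
      · right
        simp only [Finset.mem_union, not_or] at c
        refine ⟨insert a S1, S2, ?_, by simp, ?_⟩
        · rw [Finset.disjoint_insert_left]; exact ⟨c.2, hd⟩
        · rcases ih with ih | ih
          · exact Or.inl ⟨.cons hGa ih.1 c.1, ih.2⟩
          · exact Or.inr ⟨.cons hGa ih.1 c.1, ih.2⟩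
    · rcases ih with ih | ⟨S1, S2, hd, rfl, ih⟩
      · right
        refine ⟨{a}, S, by simpa using c, by rw [Finset.insert_eq], ?_⟩
        rcases ha with ha | ⟨⟨rfl, rfl⟩ | ⟨rfl, rfl⟩, -⟩
        · exact absurd ha hGa
        · exact Or.inl ⟨.single _, ih⟩
        · exact Or.inr ⟨.single _, ih⟩
      · exfalso
        simp only [Finset.mem_union, not_or] at c
        rcases ih with ih | ih
        · have := ih.1.right_mem
          have := ih.2.left_mem
          rcases ha with ha | ⟨⟨rfl, rfl⟩ | ⟨rfl, rfl⟩, -⟩ <;> tauto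
        · have := ih.1.right_mem
          have := ih.2.left_mem
          rcases ha with ha | ⟨⟨rfl, rfl⟩ | ⟨rfl, rfl⟩, -⟩ <;> tauto

def NoLong (G : SimpleGraph V) (c : ℕ) : Prop := ∀ N, HasCyc G N → N ≤ c

lemma long_path {c : ℕ} (hG : NoLong G c) {x y : V} 
    (hadd : ¬ NoLong (G ⊔ edge x y) c) : ∃ S, PathOn G x y S ∧ c + 1 ≤ S.card := by
  unfold NoLong at hadd
  push Not at hadd
  obtain ⟨N, ⟨h3, a, b, S, hp, hba, rfl⟩, hN⟩ := hadd
  rcases split_edge hp with h | ⟨S1, S2, hd, rfl, h⟩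
  · rw [sup_adj, edge_adj] at hba
    rcases hba with hba | ⟨⟨rfl, rfl⟩ | ⟨rfl, rfl⟩, -⟩
    · have := hG _ ⟨h3, a, b, S, h, hba, rfl⟩
      omega
    · exact ⟨S, h.reverse, hN⟩
    · exact ⟨S, h, hN⟩
  · have key : ∀ x y : V, PathOn G a x S1 → PathOn G y b S2 → (G ⊔ edge x y).Adj b a →
        PathOn G x y (S1 ∪ S2) := by
      intro x y h1 h2 hba
      rw [sup_adj, edge_adj] at hba
      have hd' := Finset.disjoint_left.1 hd
      rcases hba with hba | ⟨⟨rfl, rfl⟩ | ⟨rfl, rfl⟩, -⟩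
      · have := h2.append h1 hba hd.symm
        rw [Finset.union_comm]
        exact this.reverse
      · exact absurd h2.right_mem (hd' h1.right_mem)
      · rw [h1.eq_single, h2.eq_single] at h3
        have := h3.trans (Finset.card_union_le _ _)
        simp at this
    rcases h with h | h
    · exact ⟨_, key x y h.1 h.2 hba, hN⟩
    · exact ⟨_, (key y x h.1 h.2 (by rwa [edge_comm])).reverse, hN⟩

lemma exists_max [Finite V] {c : ℕ} (hG : NoLong G c) : ∃ G', G ≤ G' ∧ NoLong G' c ∧
    ∀ x y, x ≠ y → ¬ G'.Adj x y → ∃ S, PathOn G' x y S ∧ c + 1 ≤ S.card := by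
  have hfin : {G' : SimpleGraph V | NoLong G' c}.Finite := Set.toFinite _
  obtain ⟨G', hle, hmax⟩ := hfin.exists_le_maximal (show G ∈ _ from hG)
  refine ⟨G', hle, hmax.1, fun x y hxy hn => long_path hmax.1 fun h => hn ?_⟩
  have := hmax.2 h le_sup_left
  exact this (by rw [sup_adj, edge_adj]; tauto)

lemma pathOn_clique {H : Finset V} (hH : ∀ x ∈ H, ∀ y ∈ H, x ≠ y → G.Adj x y) (hne : H.Nonempty) :
    ∃ x y, PathOn G x y H := by
  induction hne using Finset.Nonempty.cons_induction with
  | singleton a => exact ⟨a, a, .single a⟩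
  | cons a s ha hs ih =>
    obtain ⟨x, y, p⟩ := ih (fun x hx y hy => hH x (by simp [hx]) y (by simp [hy]))
    refine ⟨a, y, ?_⟩
    rw [Finset.cons_eq_insert]
    exact .cons (hH a (by simp) x (by simp [p.left_mem]) (by rintro rfl; exact ha p.left_mem)) p ha

lemma clique_cyc {H : Finset V} (hH : ∀ x ∈ H, ∀ y ∈ H, x ≠ y → G.Adj x y) (h3 : 3 ≤ H.card) :
    HasCyc G H.card := by
  obtain ⟨x, y, p⟩ := pathOn_clique hH (Finset.card_pos.1 (by omega))
  refine ⟨h3, x, y, H, p, hH _ p.right_mem _ p.left_mem ?_, rfl⟩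
  rintro rfl
  rw [p.eq_single] at h3
  simp at h3

set_option linter.unusedSectionVars false
variable [Fintype V]

open Classical in
/-- the `d`-core: the largest vertex set inducing minimum degree `> d` -/
noncomputable def core (G : SimpleGraph V) (d : ℕ) : Finset V :=
  Finset.univ.filter fun v => ∃ U : Finset V, v ∈ U ∧ ∀ u ∈ U, d < (U.filter (G.Adj u)).card

open Classical in
lemma subset_core {d : ℕ} {U : Finset V} (hU : ∀ u ∈ U, d < (U.filter (G.Adj u)).card) :
    U ⊆ core G d := fun v hv => by
  simp only [core, Finset.mem_filter, Finset.mem_univ, true_and]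
  exact ⟨U, hv, hU⟩

open Classical in
lemma core_deg {d : ℕ} : ∀ u ∈ core G d, d < ((core G d).filter (G.Adj u)).card := fun u hu => by
  have hu' := hu
  simp only [core, Finset.mem_filter, Finset.mem_univ, true_and] at hu'
  obtain ⟨U, hv, hU⟩ := hu'
  exact (hU u hv).trans_le (Finset.card_le_card (Finset.filter_subset_filter _ (subset_core hU)))

open Classical in
/-- twice the number of edges inside `T` -/
noncomputable def e2 (G : SimpleGraph V) (T : Finset V) : ℕ := ∑ u ∈ T, (T.filter (G.Adj u)).card

open Classical in
lemma e2_erase {T : Finset V} {v : V} (hv : v ∈ T) :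
    e2 G T = e2 G (T.erase v) + 2 * (T.filter (G.Adj v)).card := by
  unfold e2
  rw [← Finset.add_sum_erase _ _ hv]
  have h1 : ∀ u ∈ T.erase v, (T.filter (G.Adj u)).card =
      ((T.erase v).filter (G.Adj u)).card + if G.Adj v u then 1 else 0 := by
    intro u hu
    split_ifs with h
    · rw [← Finset.insert_erase hv, Finset.filter_insert, if_pos h.symm, Finset.card_insert_of_notMem
        (by simp), Finset.erase_insert (by simp)]
    · conv_lhs => rw [← Finset.insert_erase hv, Finset.filter_insert, if_neg (fun h' => h h'.symm)]
      rfl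
  rw [Finset.sum_congr rfl h1, Finset.sum_add_distrib, ← Finset.card_filter]
  have h2 : (T.erase v).filter (G.Adj v) = T.filter (G.Adj v) := by
    ext u
    simp only [Finset.mem_filter, Finset.mem_erase]
    constructor
    · tauto
    · rintro ⟨h, h'⟩; exact ⟨⟨h'.ne', h⟩, h'⟩
  rw [h2]; ring

open Classical in
lemma e2_le (T : Finset V) : e2 G T ≤ T.card * (T.card - 1) := by
  unfold e2
  refine (Finset.sum_le_card_nsmul _ _ (T.card - 1) ?_).trans (by simp)
  intro u hu
  rw [← Finset.card_erase_of_mem hu]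
  refine Finset.card_le_card fun w hw => ?_
  simp only [Finset.mem_filter, Finset.mem_erase] at hw ⊢
  exact ⟨hw.2.ne', hw.1⟩

open Classical in
lemma elim_bound {r d : ℕ} (h : ∀ T : Finset V, r < T.card → ∃ v ∈ T, (T.filter (G.Adj v)).card ≤ d) :
    ∀ (m : ℕ) (S : Finset V), S.card = r + m → e2 G S ≤ r * (r - 1) + 2 * (m * d) := by
  intro m
  induction m with
  | zero => intro S hS; have := e2_le (G := G) S; rw [hS] at this; simpa using this
  | succ m ih =>
    intro S hS
    obtain ⟨v, hv, hd⟩ := h S (by omega)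
    rw [e2_erase hv]
    have := ih (S.erase v) (by rw [Finset.card_erase_of_mem hv, hS]; omega)
    nlinarith

open Classical in
lemma core_elim {d r : ℕ} (hr : (core G d).card ≤ r) :
    ∀ T : Finset V, r < T.card → ∃ v ∈ T, (T.filter (G.Adj v)).card ≤ d := by
  intro T hT
  by_contra hcon
  push Not at hcon
  have := Finset.card_le_card (subset_core hcon)
  omega

open Classical in
/-- The core with parameter `⌊c/2⌋` is a clique. -/
lemma core_clique {c d : ℕ} (hG : Conn2 G) (hc : 2 ≤ c) (hNL : NoLong G c)
    (hmax : ∀ x y, x ≠ y → ¬ G.Adj x y → ∃ S, PathOn G x y S ∧ c + 1 ≤ S.card)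
    (hd : c + 1 ≤ 2 * (d + 1)) :
    ∀ x ∈ core G d, ∀ y ∈ core G d, x ≠ y → G.Adj x y := by
  by_contra hcon
  push Not at hcon
  obtain ⟨x0, hx0, y0, hy0, hne0, hn0⟩ := hcon
  obtain ⟨S0, p0, hS0⟩ := hmax x0 y0 hne0 hn0
  let A : Set (Finset V) := {S | ∃ x ∈ core G d, ∃ y ∈ core G d, x ≠ y ∧ ¬ G.Adj x y ∧ PathOn G x y S ∧ c + 1 ≤ S.card}
  obtain ⟨S, ⟨x, hx, y, hy, hne, hn, p, hS⟩, hSmax⟩ := (Set.toFinite A).exists_maximalFor Finset.card A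
    ⟨S0, x0, hx0, y0, hy0, hne0, hn0, p0, hS0⟩
  have ext : ∀ x ∈ core G d, ∀ y ∈ core G d, ¬ G.Adj x y → PathOn G x y S →
      (core G d).filter (G.Adj x) ⊆ S := by
    intro x hx y hy hn p z hz
    rw [Finset.mem_filter] at hz
    by_contra hzS
    have p' := PathOn.cons hz.2.symm p hzS
    by_cases hzy : G.Adj y z
    · have := hNL _ ⟨by rw [Finset.card_insert_of_notMem hzS]; omega, _, _, _, p', hzy, rfl⟩
      rw [Finset.card_insert_of_notMem hzS] at this
      omega
    · have hc' : (insert z S).card = S.card + 1 := Finset.card_insert_of_notMem hzS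
      have := hSmax (j := insert z S) ⟨z, hz.1, y, hy, by rintro rfl; exact hzS p.right_mem,
        fun h => hzy h.symm, p', by omega⟩ (by simp only [hc']; omega)
      simp only [hc'] at this
      omega
  obtain ⟨C, hC, hcyc⟩ := kopylov_set hG p hn (ext x hx y hy hn p)
    (ext y hy x hx (fun h => hn h.symm) p.reverse) (by simp) (by simp)
    (N := c + 1) (by omega) hS (by have := core_deg x hx; have := core_deg y hy; omega)
  have := hNL C hcyc
  omega

open Classical in
/-- If the core `H` is a clique then the `(c+1-|H|)`-core coincides with `H`. -/
lemma core_eq {c d : ℕ} (hG : Conn2 G) (hc : 2 ≤ c) (hNL : NoLong G c)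
    (hmax : ∀ x y, x ≠ y → ¬ G.Adj x y → ∃ S, PathOn G x y S ∧ c + 1 ≤ S.card)
    (hd : c + 1 ≤ 2 * (d + 1)) (hr : d + 1 ≤ (core G d).card) (j : ℕ) 
    (hj : c + 1 ≤ (core G d).card + j) :
    core G j ⊆ core G d := by
  have hcl := core_clique hG hc hNL hmax hd
  by_contra hcon
  rw [Finset.not_subset] at hcon
  obtain ⟨y0, hy0, hy0'⟩ := hcon
  obtain ⟨x0, hx0, hn0⟩ : ∃ x ∈ core G d, ¬ G.Adj x y0 := by
    by_contra hall
    push Not at hall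
    refine hy0' (subset_core (U := insert y0 (core G d)) ?_ (by simp))
    intro u hu
    rcases Finset.mem_insert.1 hu with rfl | hu
    · refine lt_of_lt_of_le (Nat.lt_of_succ_le hr) (Finset.card_le_card fun z hz => ?_)
      simp [hz, (hall z hz).symm]
    · exact (core_deg u hu).trans_le
        (Finset.card_le_card (Finset.filter_subset_filter _ (by simp)))
  obtain ⟨S0, p0, hS0⟩ := hmax x0 y0 (by rintro rfl; exact hy0' hx0) hn0
  let A : Set (Finset V) := {S | ∃ x ∈ core G d, ∃ y ∈ core G j, y ∉ core G d ∧ ¬ G.Adj x y ∧ PathOn G x y S ∧ c + 1 ≤ S.card}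
  obtain ⟨S, ⟨x, hx, y, hy, hy', hn, p, hS⟩, hSmax⟩ := (Set.toFinite A).exists_maximalFor Finset.card A
    ⟨S0, x0, hx0, y0, hy0, hy0', hn0, p0, hS0⟩
  have hcyc : ∀ z ∉ S, G.Adj x z → G.Adj z y → False := by
    intro z hzS h1 h2
    have p' := PathOn.cons h1.symm p hzS
    have := hNL _ ⟨by rw [Finset.card_insert_of_notMem hzS]; omega, _, _, _, p', h2.symm, rfl⟩
    rw [Finset.card_insert_of_notMem hzS] at this
    omega
  have hlong : ∀ z ∉ S, insert z S ∉ A := by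
    intro z hzS hz
    have hc' : (insert z S).card = S.card + 1 := Finset.card_insert_of_notMem hzS
    have := hSmax hz (by simp only [hc']; omega)
    simp only [hc'] at this
    omega
  have hX : (core G d).filter (G.Adj x) ⊆ S := by
    intro z hz
    rw [Finset.mem_filter] at hz
    by_contra hzS
    exact hlong z hzS ⟨z, hz.1, y, hy, hy', fun h => hcyc z hzS hz.2 h,
      PathOn.cons hz.2.symm p hzS, hS.trans (Finset.card_le_card (by simp))⟩
  have hY : (core G j).filter (G.Adj y) ⊆ S := by
    intro z hz
    rw [Finset.mem_filter] at hz
    by_contra hzS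
    have hxz : ¬ G.Adj x z := fun h => hcyc z hzS h hz.2.symm
    have hzd : z ∉ core G d := fun h => hxz (hcl x hx z h (by rintro rfl; exact hzS p.left_mem))
    exact hlong z hzS ⟨x, hx, z, hz.1, hzd, hxz,
      p.snoc hz.2 hzS, hS.trans (Finset.card_le_card (by simp))⟩
  have hXc : (core G d).card ≤ ((core G d).filter (G.Adj x)).card + 1 := by
    have : (core G d).erase x ⊆ (core G d).filter (G.Adj x) := by
      intro z hz
      rw [Finset.mem_erase] at hz
      simp [hz.2, hcl x hx z hz.2 hz.1.symm]
    have := Finset.card_le_card this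
    rw [Finset.card_erase_of_mem hx] at this
    omega
  have hYc := core_deg y hy
  obtain ⟨C, hC, hcyc⟩ := kopylov_set hG p hn hX hY (by simp) (by simp)
    (N := c + 1) (by omega) hS (by omega)
  have := hNL C hcyc
  omega

end

section link
set_option linter.unusedSectionVars false
variable {V : Type*} [DecidableEq V] {G : SimpleGraph V}

lemma conn2_of (hG : TwoConnected G) : Conn2 G := by
  intro v x y hx hy
  obtain ⟨w, hw⟩ := ((hG.2 v).preconnected ⟨x, hx⟩ ⟨y, hy⟩).exists_isPath
  let f : G.induce {u | u ≠ v} →g G := (Embedding.induce _).toHom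
  have hf : Function.Injective f := (Embedding.induce (G := G) {u | u ≠ v}).injective
  have p := PathOn.of_walk (w.map f) (hw.map hf)
  refine ⟨_, ?_, p⟩
  simp only [Walk.support_map, List.mem_toFinset, List.mem_map, not_exists, not_and]
  rintro ⟨z, hz⟩ - h
  exact hz h

lemma Conn2.mono {G' : SimpleGraph V} (h : Conn2 G) (hle : G ≤ G') : Conn2 G' := by
  intro v x y hx hy
  obtain ⟨S, hS, p⟩ := h v x y hx hy
  exact ⟨S, hS, p.mono hle⟩

lemma walk_of_hasCyc {N : ℕ} (h : HasCyc G N) :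
    ∃ (v : V) (w : G.Walk v v), w.IsCycle ∧ w.length = N := by
  obtain ⟨h3, x, y, S, p, ha, rfl⟩ := h
  obtain ⟨x', hx', p'⟩ := p.tail ha.ne'
  obtain ⟨w, hw, hs⟩ := p'.to_walk
  have hxw : x ∉ w.support := fun h => by
    have : x ∈ S.erase x := by rw [← hs]; simpa using h
    simp at this
  have hcard : S.card = w.length + 2 := by
    have h1 : (S.erase x).card = w.length + 1 := by
      rw [← hs, List.toFinset_card_of_nodup hw.support_nodup, Walk.length_support]
    rw [Finset.card_erase_of_mem p.left_mem] at h1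
    omega
  refine ⟨y, .cons ha (.cons hx' w), ?_, by simp [hcard]⟩
  rw [Walk.cons_isCycle_iff, Walk.cons_isPath_iff]
  refine ⟨⟨hw, hxw⟩, ?_⟩
  rw [Walk.edges_cons, List.mem_cons, not_or]
  refine ⟨fun h => ?_, fun h => hxw (w.snd_mem_support_of_mem_edges h)⟩
  have hyx : y = x' := by
    have hne := ha.ne
    simp only [Sym2.eq_iff] at h
    tauto
  subst hyx
  have hnil : w = .nil := by simpa using hw
  rw [hnil] at hcard
  simp at hcard
  omega

lemma bdd_cyc [Finite V] : BddAbove {n | ∃ (v : V) (w : G.Walk v v), w.IsCycle ∧ w.length = n} := by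
  classical
  have := Fintype.ofFinite V
  refine ⟨Fintype.card V, ?_⟩
  rintro n ⟨v, w, hw, rfl⟩
  have := hw.support_nodup.length_le_card
  simpa using this

lemma le_circ [Finite V] {N : ℕ} (h : HasCyc G N) : N ≤ circ G :=
  le_csSup bdd_cyc (walk_of_hasCyc h)

lemma noLong_circ [Finite V] : NoLong G (circ G) := fun _ h => le_circ h

lemma cycle_path {v u : V} {w : G.Walk v v} (hw : w.IsCycle) (hu : u ∈ w.support) :
    ∃ y S, PathOn G u y S ∧ G.Adj y u ∧ S.card = w.length ∧ ∀ z, z ∈ S → z ∈ w.support := by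
  have hr := hw.rotate hu
  have hl : (w.rotate u hu).length = w.length := by simp
  have hs : ∀ z, z ∈ (w.rotate u hu).support → z ∈ w.support := by
    intro z; simp
  generalize w.rotate u hu = w' at hr hl hs
  cases w' with
  | nil => simp at hr
  | @cons _ y _ a q =>
    rw [Walk.cons_isCycle_iff] at hr
    refine ⟨y, _, (PathOn.of_walk q hr.1).reverse, a.symm, ?_, ?_⟩
    · rw [List.toFinset_card_of_nodup hr.1.support_nodup, Walk.length_support, ← hl]; simp
    · intro z hz
      exact hs z (by simp at hz ⊢; tauto)

open Classical in
lemma degN_eq [Fintype V] (v : V) : degN G v = (Finset.univ.filter (G.Adj v)).card := by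
  unfold degN
  rw [Nat.card_eq_fintype_card, ← Set.toFinset_card]
  congr 1; ext; simp

open Classical in
lemma edgeCount_eq [Fintype V] : 2 * edgeCount G = e2 G Finset.univ := by
  unfold edgeCount e2
  rw [Nat.card_eq_fintype_card, ← edgeFinset_card, ← sum_degrees_eq_twice_card_edges]
  refine Finset.sum_congr rfl fun v _ => ?_
  rw [← card_neighborFinset_eq_degree]
  congr 1; ext; simp

end link

lemma two_choose (m : ℕ) : 2 * m.choose 2 = m * (m - 1) := by
  rw [Nat.choose_two_right, Nat.mul_div_cancel' (Nat.even_mul_pred_self m).two_dvd]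

lemma two_f (n c j : ℕ) : 2 * fCliques n c j 2 = (c + 1 - j) * (c + 1 - j - 1) + 2 * ((n + j - c - 1) * j) := by
  unfold fCliques
  rw [mul_add, two_choose]; simp

lemma two_g (n c k : ℕ) : 2 * gCliques n c k 2 = (c + 1 - c / 2) * (c + 1 - c / 2 - 1) +
    2 * ((n + c / 2 - c - 2) * (c / 2)) + 2 * k := by
  unfold gCliques
  rw [mul_add, mul_add, two_choose]; simp

lemma convex_aux (n c k j : ℕ) (h1 : c + 1 ≤ n) (hkj : k ≤ j) (hj : j + 1 ≤ c / 2) (hk : 2 ≤ k) :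
    fCliques n c j 2 ≤ max (fCliques n c k 2) (gCliques n c k 2) := by
  rw [le_max_iff]
  by_contra! hcon
  obtain ⟨hf, hg⟩ := hcon
  have ef := two_f n c j
  have ek := two_f n c k
  have eg := two_g n c k
  have ht : 2 * (c / 2) ≤ c := by omega
  generalize c / 2 = t at *
  generalize fCliques n c j 2 = Fj at *
  generalize fCliques n c k 2 = Fk at *
  generalize gCliques n c k 2 = Gk at *
  obtain ⟨m, rfl⟩ := Nat.exists_eq_add_of_le h1
  obtain ⟨a, rfl⟩ := Nat.exists_eq_add_of_le hkj
  obtain ⟨b, rfl⟩ := Nat.exists_eq_add_of_le hj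
  obtain ⟨d, rfl⟩ := Nat.exists_eq_add_of_le ht
  generalize hc : 2 * (k + a + 1 + b) + d = c at *
  rw [show c + 1 - (k + a) - 1 = c - (k + a) by omega,
    show c + 1 - (k + a) = (c - (k + a)) + 1 by omega,
    show c + 1 + m + (k + a) - c - 1 = m + k + a by omega] at ef
  rw [show c + 1 - k - 1 = c - k by omega,
    show c + 1 - k = (c - k) + 1 by omega,
    show c + 1 + m + k - c - 1 = m + k by omega] at ek
  rw [show c + 1 - (k + a + 1 + b) - 1 = c - (k + a + 1 + b) by omega,
    show c + 1 - (k + a + 1 + b) = (c - (k + a + 1 + b)) + 1 by omega,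
    show c + 1 + m + (k + a + 1 + b) - c - 2 = m + k + a + b by omega] at eg
  rw [show c - (k + a) = k + a + 2 + 2 * b + d by omega] at ef
  rw [show c - k = k + 2 * a + 2 + 2 * b + d by omega] at ek
  rw [show c - (k + a + 1 + b) = k + a + 1 + b + d by omega] at eg
  zify at *
  have e1 : (2 * Fj - 2 * Fk : ℤ) = a * (2 * m + 2 * k - a - 4 * b - 2 * d - 5) := by
    rw [ef, ek]; ring
  have e2 : (2 * Gk - 2 * Fj : ℤ) = (b + 1) * ((2 * m + 2 * k - a - 4 * b - 2 * d - 5) + 3 * a + 3 * (b + 1))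
      - 2 * (a + b + 1) := by
    rw [ef, eg]; ring
  generalize (2 * m + 2 * k - a - 4 * b - 2 * d - 5 : ℤ) = E at e1 e2
  have ha : (0 : ℤ) ≤ a := by positivity
  have hb : (0 : ℤ) ≤ b := by positivity
  have hE : 1 ≤ E := by
    by_contra hE
    have : (a : ℤ) * E ≤ 0 := mul_nonpos_of_nonneg_of_nonpos ha (by omega)
    omega
  have : (0 : ℤ) ≤ b * (E + 3 * a + 3 * (b + 1)) := by positivity
  nlinarith

open Classical in
lemma upper (n c k : ℕ) (h1 : c ≤ n - 1) (h2 : 2 * k ≤ c) (h3 : 2 ≤ k)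
    (V : Type) (G : SimpleGraph V) (hn : Nat.card V = n) (hG : TwoConnected G) (hc : circ G = c)
    (hk : MinDegreeEq G k) : edgeCount G ≤ max (fCliques n c k 2) (gCliques n c k 2) := by
  have hfin : Finite V := Nat.finite_of_card_ne_zero (by omega)
  have := Fintype.ofFinite V
  have hcard : (Finset.univ : Finset V).card = n := by
    rw [← hn, Nat.card_eq_fintype_card]; rfl
  have hNL : NoLong G c := hc ▸ noLong_circ
  obtain ⟨G', hle, hNL', hmax⟩ := exists_max hNL
  have hG' : Conn2 G' := (conn2_of hG).mono hle
  have filter_le : ∀ (T : Finset V) (u : V), (T.filter (G.Adj u)).card ≤ (T.filter (G'.Adj u)).card := by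
    intro T u
    refine Finset.card_le_card fun z hz => ?_
    simp only [Finset.mem_filter] at hz ⊢
    exact ⟨hz.1, hle hz.2⟩
  have elim : ∀ d r, (core G' d).card ≤ r → ∀ T : Finset V, r < T.card →
      ∃ v ∈ T, (T.filter (G.Adj v)).card ≤ d := by
    intro d r hr T hT
    obtain ⟨v, hv, h⟩ := core_elim hr T hT
    exact ⟨v, hv, (filter_le T v).trans h⟩
  have htc : c + 1 ≤ 2 * (c / 2 + 1) := by omega
  by_cases hr : (core G' (c / 2)).card ≤ c + 1 - c / 2
  · obtain ⟨v, hv⟩ := hk.2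
    rw [le_max_iff]; right
    have hb := elim_bound (elim (c / 2) _ hr) (n - 1 - (c + 1 - c / 2)) (Finset.univ.erase v) (by
      rw [Finset.card_erase_of_mem (by simp), hcard]; omega)
    have he := edgeCount_eq (G := G)
    rw [e2_erase (Finset.mem_univ v), ← degN_eq, hv] at he
    have hg := two_g n c k
    rw [show n - 1 - (c + 1 - c / 2) = n + c / 2 - c - 2 by omega] at hb
    omega
  · have hcl := core_clique hG' (by omega) hNL' hmax htc
    have hrc : (core G' (c / 2)).card ≤ c := by
      by_contra hcon
      exact hcon (hNL' _ (clique_cyc hcl (by omega)))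
    have hsub := core_eq hG' (by omega) hNL' hmax htc (by omega) (c + 1 - (core G' (c / 2)).card) (by omega)
    by_cases hjk : c + 1 - (core G' (c / 2)).card < k
    · exfalso
      have : Finset.univ ⊆ core G' (c + 1 - (core G' (c / 2)).card) := by
        refine subset_core fun u _ => ?_
        have := filter_le Finset.univ u
        rw [← degN_eq] at this
        have := hk.1 u
        omega
      have := Finset.card_le_card (this.trans hsub)
      omega
    · have hb := elim_bound (elim (c + 1 - (core G' (c / 2)).card) _ (Finset.card_le_card hsub)) (n - (core G' (c / 2)).card)
        Finset.univ (by rw [hcard]; omega)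
      rw [← edgeCount_eq] at hb
      have hf := two_f n c (c + 1 - (core G' (c / 2)).card)
      refine le_trans ?_ (convex_aux n c k (c + 1 - (core G' (c / 2)).card) (by omega) (by omega) (by omega) h3)
      rw [show c + 1 - (c + 1 - (core G' (c / 2)).card) = (core G' (c / 2)).card by omega,
        show n + (c + 1 - (core G' (c / 2)).card) - c - 1 = n - (core G' (c / 2)).card by omega] at hf
      omega

/-! ### Constructions -/

section constr

lemma dom_twoConnected {n : ℕ} (hn : 3 ≤ n) (G : SimpleGraph (Fin n))
    (h : ∀ x y : Fin n, x.val < 2 → x ≠ y → G.Adj x y) : TwoConnected G := by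
  refine ⟨by simpa using hn, fun v => ?_⟩
  obtain ⟨z, hz, hzv⟩ : ∃ z : Fin n, z.val < 2 ∧ z ≠ v := by
    by_cases hv : v.val = 0
    · exact ⟨⟨1, by omega⟩, by simp, by rw [Ne, Fin.ext_iff]; simp; omega⟩
    · exact ⟨⟨0, by omega⟩, by simp, by rw [Ne, Fin.ext_iff]; simp; omega⟩
  rw [connected_iff_exists_forall_reachable]
  refine ⟨⟨z, hzv⟩, fun ⟨y, hy⟩ => ?_⟩
  by_cases hzy : z = y
  · subst hzy; rfl
  · exact Adj.reachable (h z y hz hzy)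

/-- counting vertices on paths of `Fgraph n c j` -/
lemma F_path {n c j : ℕ} (hc : 2 * j ≤ c) {x y : Fin n} {S : Finset (Fin n)}
    (h : PathOn (Fgraph n c j) x y S) :
    (S.filter (fun z => c - j < z.val)).card +
      (if (S.filter (fun z => j ≤ z.val ∧ z.val ≤ c - j)).Nonempty then 1 else 0) +
      (if x.val < j then 1 else 0) ≤ (S.filter (fun z => z.val < j)).card + 1 := by
  induction h with
  | single x =>
    simp only [Finset.filter_singleton]
    split_ifs <;> first | omega | simp_all
  | @cons x x' y S a p hx ih =>
    obtain ⟨-, a⟩ := a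
    have hx' : ∀ (P : Fin n → Prop) [DecidablePred P], x ∉ S.filter P := fun P _ h =>
      hx (Finset.mem_filter.1 h).1
    by_cases h1 : x.val < j
    · have e1 : ¬ (c - j < x.val) := by omega
      have e2 : ¬ (j ≤ x.val ∧ x.val ≤ c - j) := by omega
      simp only [Finset.filter_insert, h1, e1, e2, if_true, if_false]
      rw [Finset.card_insert_of_notMem (hx' _)]
      split_ifs at ih ⊢ <;> omega
    by_cases h2 : c - j < x.val
    · have e2 : ¬ (j ≤ x.val ∧ x.val ≤ c - j) := by omega
      have e3 : x'.val < j := by omega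
      simp only [Finset.filter_insert, h1, h2, e2, if_true, if_false]
      rw [Finset.card_insert_of_notMem (hx' _)]
      simp only [e3, if_true] at ih
      split_ifs at ih ⊢ <;> omega
    · have e2 : (j ≤ x.val ∧ x.val ≤ c - j) := by omega
      simp only [Finset.filter_insert, h1, h2, e2, if_false, and_self, if_true,
        Finset.insert_nonempty]
      by_cases e3 : x'.val < j
      · simp only [e3, if_true] at ih
        split_ifs at ih ⊢ <;> omega
      · have e4 : (S.filter (fun z => j ≤ z.val ∧ z.val ≤ c - j)).Nonempty :=
          ⟨x', by rw [Finset.mem_filter]; exact ⟨p.left_mem, by omega⟩⟩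
        simp only [e4, e3, if_true, if_false] at ih
        omega

lemma fin_filter_card_le {n : ℕ} (S : Finset (Fin n)) (a b : ℕ) :
    (S.filter (fun z => a ≤ z.val ∧ z.val < b)).card ≤ b - a := by
  rw [← Finset.card_map Fin.valEmbedding, ← Nat.card_Ico]
  refine Finset.card_le_card fun z hz => ?_
  simp only [Finset.mem_map, Finset.mem_filter, Fin.valEmbedding_apply] at hz
  obtain ⟨x, hx, rfl⟩ := hz
  simpa using hx.2

/-- cycles of `Fgraph n c j` have at most `c` vertices -/
lemma F_cyc {n c j : ℕ} (hc : 2 * j ≤ c) (hj : 1 ≤ j)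
    {v : Fin n} {w : (Fgraph n c j).Walk v v} (hw : w.IsCycle) : w.length ≤ c := by
  have split : ∀ S : Finset (Fin n), S.card = (S.filter (fun z => z.val < j)).card +
      (S.filter (fun z => j ≤ z.val ∧ z.val ≤ c - j)).card +
      (S.filter (fun z => c - j < z.val)).card := by
    intro S
    simp only [Finset.card_filter, ← Finset.sum_add_distrib]
    rw [Finset.card_eq_sum_ones]
    refine Finset.sum_congr rfl fun z _ => ?_
    split_ifs <;> omega
  have kcard : ∀ S : Finset (Fin n), (S.filter (fun z => z.val < j)).card ≤ j := by
    intro S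
    simpa using fin_filter_card_le S 0 j
  have mcard : ∀ S : Finset (Fin n), (S.filter (fun z => j ≤ z.val ∧ z.val ≤ c - j)).card ≤ c + 1 - 2 * j := by
    intro S
    have := fin_filter_card_le S j (c - j + 1)
    simp only [Nat.lt_succ_iff] at this
    omega
  have h3 := hw.three_le_length
  by_cases hK : ∃ u ∈ w.support, u.val < j
  · obtain ⟨u, hu, huj⟩ := hK
    obtain ⟨y, S, p, -, hS, -⟩ := cycle_path hw hu
    have := F_path hc p
    have h1 := split S
    have h2 := kcard S
    have h4 := mcard S
    rw [if_pos huj] at this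
    split_ifs at this with hM
    · omega
    · rw [Finset.not_nonempty_iff_eq_empty] at hM
      rw [hM] at h1
      simp only [Finset.card_empty] at h1
      omega
  · push Not at hK
    obtain ⟨y, S, p, -, hS, hsub⟩ := cycle_path hw w.start_mem_support
    have := F_path hc p
    have h1 := split S
    have h4 := mcard S
    have h5 : S.filter (fun z => z.val < j) = ∅ := by
      rw [Finset.filter_eq_empty_iff]
      intro z hz
      have := hK z (hsub z hz)
      omega
    rw [h5] at this h1
    simp only [Finset.card_empty] at this h1
    omega

/-- a cycle of length `c` avoiding the last vertex -/
lemma F_long {n c j : ℕ} (hc : 2 * j ≤ c) (hc3 : 3 ≤ c) (hj : 1 ≤ j) (hn : c < n)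
    (G : SimpleGraph (Fin n))
    (hG : ∀ x y, x.val < n - 1 → y.val < n - 1 → (Fgraph n c j).Adj x y → G.Adj x y) :
    HasCyc G c := by
  -- the clique part, as a path starting at vertex `j`
  have base : ∀ d, j + d ≤ c - j → ∃ x y : Fin n, x.val = j ∧ y.val = j + d ∧
      PathOn G x y (Finset.univ.filter fun z => j ≤ z.val ∧ z.val ≤ j + d) := by
    intro d
    induction d with
    | zero =>
      intro h
      refine ⟨⟨j, by omega⟩, ⟨j, by omega⟩, rfl, rfl, ?_⟩
      have : (Finset.univ.filter fun z : Fin n => j ≤ z.val ∧ z.val ≤ j + 0) = {⟨j, by omega⟩} := by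
        ext z; simp [Fin.ext_iff]; omega
      rw [this]; exact .single _
    | succ d ih =>
      intro h
      obtain ⟨x, y, hx, hy, p⟩ := ih (by omega)
      have := p.snoc (z := ⟨j + d + 1, by omega⟩)
        (hG _ _ (by omega) (by simp <;> omega) ⟨by rw [Ne, Fin.ext_iff]; simp <;> omega, by simp <;> omega⟩) (by simp)
      refine ⟨x, ⟨j + d + 1, by omega⟩, hx, rfl, ?_⟩
      convert this using 1
      ext z; simp [Fin.ext_iff]; omega
  have alt : ∀ i, i + 1 ≤ j → ∃ x y : Fin n, x.val = j ∧ y.val = i ∧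
      PathOn G x y (Finset.univ.filter fun z => z.val ≤ i ∨ (j ≤ z.val ∧ z.val ≤ c - j + i)) := by
    intro i
    induction i with
    | zero =>
      intro h
      obtain ⟨x, y, hx, hy, p⟩ := base (c - 2 * j) (by omega)
      have := p.snoc (z := ⟨0, by omega⟩)
        (hG _ _ (by omega) (by simp <;> omega) ⟨by rw [Ne, Fin.ext_iff]; simp <;> omega, by simp <;> omega⟩) (by simp <;> omega)
      refine ⟨x, ⟨0, by omega⟩, hx, rfl, ?_⟩
      convert this using 1
      ext z; simp [Fin.ext_iff]; omega
    | succ i ih =>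
      intro h
      obtain ⟨x, y, hx, hy, p⟩ := ih (by omega)
      have p1 := p.snoc (z := ⟨c - j + i + 1, by omega⟩)
        (hG _ _ (by omega) (by simp <;> omega) ⟨by rw [Ne, Fin.ext_iff]; simp <;> omega, by simp <;> omega⟩) (by simp <;> omega)
      have p2 := p1.snoc (z := ⟨i + 1, by omega⟩)
        (hG ⟨c - j + i + 1, by omega⟩ ⟨i + 1, by omega⟩ (by simp <;> omega) (by simp <;> omega) ⟨by rw [Ne, Fin.ext_iff]; simp <;> omega, by simp <;> omega⟩)
          (by simp <;> omega)
      refine ⟨x, ⟨i + 1, by omega⟩, hx, rfl, ?_⟩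
      convert p2 using 1
      ext z; simp [Fin.ext_iff]; omega
  obtain ⟨x, y, hx, hy, p⟩ := alt (j - 1) (by omega)
  refine ⟨hc3, x, y, _, p, hG _ _ (by omega) (by omega) ⟨by rw [Ne, Fin.ext_iff]; omega, by omega⟩, ?_⟩
  have : (Finset.univ.filter fun z : Fin n => z.val ≤ j - 1 ∨ (j ≤ z.val ∧ z.val ≤ c - j + (j - 1)))
      = Finset.univ.filter fun z : Fin n => z.val < c := by
    ext z; simp; omega
  rw [this, Fin.card_filter_val_lt]
  omega

lemma F_circ {n c j : ℕ} (hc : 2 * j ≤ c) (hc3 : 3 ≤ c) (hj : 1 ≤ j) (hn : c < n)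
    (G : SimpleGraph (Fin n)) (hle : G ≤ Fgraph n c j)
    (hG : ∀ x y, x.val < n - 1 → y.val < n - 1 → (Fgraph n c j).Adj x y → G.Adj x y) :
    circ G = c := by
  have hL := F_long hc hc3 hj hn G hG
  refine le_antisymm ?_ (le_circ hL)
  refine csSup_le ⟨c, walk_of_hasCyc hL⟩ ?_
  rintro m ⟨v, w, hw, rfl⟩
  have hw' := hw.mapLe hle
  have := F_cyc hc hj hw'
  simpa using this

lemma minDeg {n k : ℕ} (hk : k + 1 ≤ n) (G : SimpleGraph (Fin n))
    (h : ∀ x y : Fin n, x.val < k → x ≠ y → G.Adj x y)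
    (hl : ∀ x y : Fin n, x.val = n - 1 → G.Adj x y → y.val < k) : MinDegreeEq G k := by
  classical
  refine ⟨fun v => ?_, ⟨n - 1, by omega⟩, ?_⟩
  · rw [degN_eq]
    by_cases hv : v.val < k
    · have : (Finset.univ.erase v) ⊆ Finset.univ.filter (G.Adj v) := by
        intro z hz
        simp only [Finset.mem_erase, Finset.mem_filter, Finset.mem_univ, true_and, and_true] at hz ⊢
        exact h v z hv hz.symm
      have := Finset.card_le_card this
      rw [Finset.card_erase_of_mem (by simp), Finset.card_univ, Fintype.card_fin] at this
      omega
    · have : (Finset.univ.filter fun z : Fin n => z.val < k) ⊆ Finset.univ.filter (G.Adj v) := by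
        intro z hz
        simp only [Finset.mem_filter, Finset.mem_univ, true_and] at hz ⊢
        exact (h z v hz (by rintro rfl; exact hv hz)).symm
      have := Finset.card_le_card this
      rw [Fin.card_filter_val_lt] at this
      omega
  · rw [degN_eq]
    have : (Finset.univ.filter (G.Adj ⟨n - 1, by omega⟩)) = Finset.univ.filter fun z : Fin n => z.val < k := by
      ext z
      simp only [Finset.mem_filter, Finset.mem_univ, true_and]
      refine ⟨hl _ z rfl, fun hz => (h z _ hz ?_).symm⟩
      rw [Ne, Fin.ext_iff]; simp; omega
    rw [this, Fin.card_filter_val_lt]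
    omega

/-- the number of edges of `Fgraph`, first inside initial segments -/
lemma F_e2 {n c j : ℕ} (hc : 2 * j ≤ c) (hn : c < n) (m : ℕ) (hm : c + 1 - j + m ≤ n) :
    e2 (Fgraph n c j) (Finset.univ.filter fun z : Fin n => z.val < c + 1 - j + m) =
      (c + 1 - j) * (c - j) + 2 * (m * j) := by
  classical
  induction m with
  | zero =>
    unfold e2
    rw [Finset.sum_congr rfl (g := fun _ => c - j)]
    · rw [Finset.sum_const, Fin.card_filter_val_lt]
      simp; left; omega
    · intro u hu
      simp only [Finset.mem_filter, Finset.mem_univ, true_and] at hu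
      have : ((Finset.univ.filter fun z : Fin n => z.val < c + 1 - j + 0).filter ((Fgraph n c j).Adj u)) =
          (Finset.univ.filter fun z : Fin n => z.val < c + 1 - j + 0).erase u := by
        ext z
        simp only [Finset.mem_filter, Finset.mem_univ, true_and, Finset.mem_erase, Fgraph, Ne, Fin.ext_iff]
        omega
      rw [this, Finset.card_erase_of_mem (by simpa using hu), Fin.card_filter_val_lt]
      omega
  | succ m ih =>
    have hv : (⟨c + 1 - j + m, by omega⟩ : Fin n) ∈
      (Finset.univ.filter fun z : Fin n => z.val < c + 1 - j + (m + 1)) := by simp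
    rw [e2_erase hv]
    have h1 : (Finset.univ.filter fun z : Fin n => z.val < c + 1 - j + (m + 1)).erase
        ⟨c + 1 - j + m, by omega⟩ = Finset.univ.filter fun z : Fin n => z.val < c + 1 - j + m := by
      ext z
      simp only [Finset.mem_filter, Finset.mem_univ, true_and, Finset.mem_erase, Ne, Fin.ext_iff]
      omega
    have h2 : ((Finset.univ.filter fun z : Fin n => z.val < c + 1 - j + (m + 1)).filter
        ((Fgraph n c j).Adj ⟨c + 1 - j + m, by omega⟩)) = Finset.univ.filter fun z : Fin n => z.val < j := by
      ext z
      simp only [Finset.mem_filter, Finset.mem_univ, true_and, Fgraph, Ne, Fin.ext_iff]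
      omega
    rw [h1, h2, ih (by omega), Fin.card_filter_val_lt, Nat.min_eq_right (by omega)]
    ring

lemma F_example (n c k : ℕ) (h1 : c ≤ n - 1) (h2 : 2 * k ≤ c) (h3 : 2 ≤ k) :
    TwoConnected (Fgraph n c k) ∧ circ (Fgraph n c k) = c ∧ MinDegreeEq (Fgraph n c k) k ∧
      edgeCount (Fgraph n c k) = fCliques n c k 2 := by
  refine ⟨?_, ?_, ?_, ?_⟩
  · exact dom_twoConnected (by omega) _ fun x y hx hxy => ⟨hxy, by omega⟩
  · exact F_circ h2 (by omega) (by omega) (by omega) _ le_rfl fun x y _ _ h => h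
  · refine minDeg (by omega) _ (fun x y hx hxy => ⟨hxy, by omega⟩) ?_
    rintro x y hx ⟨-, h⟩
    omega
  · have h := F_e2 (n := n) (c := c) (j := k) h2 (by omega) (n + k - c - 1) (by omega)
    have e : (Finset.univ.filter fun z : Fin n => z.val < c + 1 - k + (n + k - c - 1)) = Finset.univ := by
      ext z; simp; omega
    rw [e, ← edgeCount_eq] at h
    have hf := two_f n c k
    rw [show c + 1 - k - 1 = c - k by omega] at hf
    omega

lemma G_adj (n c k : ℕ) (x y : Fin n) : (Ggraph n c k).Adj x y ↔ (Fgraph n c (c / 2)).Adj x y ∧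
    ¬ (x.val = n - 1 ∧ k ≤ y.val ∧ y.val < c / 2) ∧ ¬ (y.val = n - 1 ∧ k ≤ x.val ∧ x.val < c / 2) := by
  unfold Ggraph
  rw [deleteEdges_adj]
  refine and_congr_right fun _ => ?_
  simp only [Set.mem_ofPred_eq, Sym2.eq_iff]
  constructor
  · intro h
    exact ⟨fun h' => h ⟨x, y, Or.inl ⟨rfl, rfl⟩, h'⟩, fun h' => h ⟨y, x, Or.inr ⟨rfl, rfl⟩, h'⟩⟩
  · rintro ⟨h, h'⟩ ⟨a, b, ⟨rfl, rfl⟩ | ⟨rfl, rfl⟩, hh⟩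
    · exact h hh
    · exact h' hh

lemma G_example (n c k : ℕ) (h1 : c ≤ n - 1) (h2 : 2 * k ≤ c) (h3 : 2 ≤ k) :
    TwoConnected (Ggraph n c k) ∧ circ (Ggraph n c k) = c ∧ MinDegreeEq (Ggraph n c k) k ∧
      edgeCount (Ggraph n c k) = gCliques n c k 2 := by
  classical
  have hdom : ∀ x y : Fin n, x.val < k → x ≠ y → (Ggraph n c k).Adj x y := by
    intro x y hx hxy
    rw [G_adj]
    exact ⟨⟨hxy, by omega⟩, by omega, by omega⟩
  have hmin : MinDegreeEq (Ggraph n c k) k := by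
    refine minDeg (by omega) _ hdom ?_
    intro x y hx h
    rw [G_adj] at h
    obtain ⟨⟨-, h⟩, h', -⟩ := h
    omega
  refine ⟨?_, ?_, hmin, ?_⟩
  · exact dom_twoConnected (by omega) _ fun x y hx hxy => hdom x y (by omega) hxy
  · refine F_circ (j := c / 2) (by omega) (by omega) (by omega) (by omega) _ ?_ ?_
    · intro x y h; exact ((G_adj n c k x y).1 h).1
    · intro x y hx hy h
      rw [G_adj]
      exact ⟨h, by omega, by omega⟩
  · have h := F_e2 (n := n) (c := c) (j := c / 2) (by omega) (by omega) (n + c / 2 - c - 2) (by omega)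
    have e : (Finset.univ.filter fun z : Fin n => z.val < c + 1 - c / 2 + (n + c / 2 - c - 2)) =
        Finset.univ.erase ⟨n - 1, by omega⟩ := by
      ext z; simp [Fin.ext_iff]; omega
    have e' : e2 (Ggraph n c k) (Finset.univ.erase ⟨n - 1, by omega⟩) =
        e2 (Fgraph n c (c / 2)) (Finset.univ.erase ⟨n - 1, by omega⟩) := by
      unfold e2
      refine Finset.sum_congr rfl fun u hu => ?_
      congr 1
      refine Finset.filter_congr fun z hz => ?_
      simp only [Finset.mem_erase, Finset.mem_univ, and_true, Ne, Fin.ext_iff] at hu hz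
      rw [G_adj]
      tauto
    have hdeg : degN (Ggraph n c k) ⟨n - 1, by omega⟩ = k := by
      rw [degN_eq]
      have : (Finset.univ.filter ((Ggraph n c k).Adj ⟨n - 1, by omega⟩)) =
          Finset.univ.filter fun z : Fin n => z.val < k := by
        ext z
        simp only [Finset.mem_filter, Finset.mem_univ, true_and]
        rw [G_adj]
        simp only [Fgraph, Ne, Fin.ext_iff, true_and]
        omega
      rw [this, Fin.card_filter_val_lt]
      omega
    have he := edgeCount_eq (G := Ggraph n c k)
    rw [e2_erase (Finset.mem_univ ⟨n - 1, by omega⟩), ← degN_eq, hdeg, e', ← e, h] at he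
    have hg := two_g n c k
    rw [show c + 1 - c / 2 - 1 = c - c / 2 by omega] at hg
    omega

end constr

theorem stmt3 (n c k : ℕ) (h1 : c ≤ n - 1) (h2 : 2 * k ≤ c) (h3 : 2 ≤ k) :
    (∀ (V : Type) (G : SimpleGraph V), Nat.card V = n → TwoConnected G → circ G = c →
      MinDegreeEq G k → edgeCount G ≤ max (fCliques n c k 2) (gCliques n c k 2)) ∧
    (∃ G : SimpleGraph (Fin n), TwoConnected G ∧ circ G = c ∧ MinDegreeEq G k ∧
      edgeCount G = max (fCliques n c k 2) (gCliques n c k 2)) := by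
  refine ⟨fun V G hn hG hc hk => upper n c k h1 h2 h3 V G hn hG hc hk, ?_⟩
  rcases le_total (fCliques n c k 2) (gCliques n c k 2) with h | h
  · rw [max_eq_right h]
    exact ⟨_, G_example n c k h1 h2 h3⟩
  · rw [max_eq_left h]
    exact ⟨_, F_example n c k h1 h2 h3⟩
end

section
/- Let G be a 2-connected graph and let P be a path in G of length m (i.e., with m edges) from vertex x to vertex y. Then the circumference of G satisfies c(G) ≥ min{m+1, d_P(x) + d_P(y)}, where d_P(v) denotes the number of neighbors of v that lie on P. -/
open SimpleGraph

/-- `HP G u v S`: there is a path of `G` from `u` to `v` whose vertex set is `S`. -/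
inductive HP {V : Type} (G : SimpleGraph V) : V → V → Set V → Prop
  | single (u : V) : HP G u u {u}
  | cons {u w v : V} {S : Set V} : G.Adj u w → HP G w v S → u ∉ S → HP G u v (insert u S)

namespace HP

variable {V : Type} {G : SimpleGraph V}

lemma left_mem {u v : V} {S : Set V} (h : HP G u v S) : u ∈ S := by
  cases h <;> simp

lemma right_mem {u v : V} {S : Set V} (h : HP G u v S) : v ∈ S := by
  induction h with
  | single u => simp
  | cons _ _ _ ih => exact Set.mem_insert_of_mem _ ih

lemma glue {u v w : V} {S T : Set V} (h : HP G u v S) (h' : HP G v w T)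
    (hd : ∀ z, z ∈ S → z ∈ T → z = v) : HP G u w (S ∪ T) := by
  induction h with
  | single u =>
    have : ({u} : Set V) ∪ T = T := by
      have := h'.left_mem
      simpa using this
    rwa [this]
  | @cons u w' v S ha hS hu ih =>
    rw [Set.insert_union]
    refine HP.cons ha (ih h' fun z hz hz' => hd z (Set.mem_insert_of_mem _ hz) hz') ?_
    rintro (h1 | h1)
    · exact hu h1
    · have := hd u (Set.mem_insert _ _) h1
      subst this
      exact hu hS.right_mem

lemma edge {u v : V} (h : G.Adj u v) : HP G u v {u, v} :=
  HP.cons h (HP.single v) (by simpa using h.ne)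

lemma symm {u v : V} {S : Set V} (h : HP G u v S) : HP G v u S := by
  induction h with
  | single u => exact HP.single u
  | @cons u w v S ha hS hu ih =>
    have := ih.glue (edge ha.symm) (by
      rintro z hz (h1 | h1)
      · exact h1
      · exact absurd (h1 ▸ hz) hu)
    have e : S ∪ {w, u} = insert u S := by
      have := hS.left_mem
      ext z
      simp only [Set.mem_union, Set.mem_insert_iff, Set.mem_singleton_iff]
      grind
    rwa [e] at this

lemma join {u v w x : V} {S T : Set V} (h : HP G u v S) (ha : G.Adj v w) (h' : HP G w x T)
    (hd : ∀ z, z ∈ S → z ∉ T) : HP G u x (S ∪ T) := by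
  have hv := h.right_mem
  have := h.glue (HP.cons ha h' (hd v hv)) (by
    rintro z hz (h1 | h1)
    · exact h1
    · exact absurd h1 (hd z hz))
  have e : S ∪ insert v T = S ∪ T := by
    ext z
    simp only [Set.mem_union, Set.mem_insert_iff]
    grind
  rwa [e] at this

lemma split {u v : V} {S : Set V} (h : HP G u v S) {z : V} (hz : z ∈ S) :
    ∃ S1 S2, HP G u z S1 ∧ HP G z v S2 ∧ (∀ x, x ∈ S1 → x ∈ S2 → x = z) ∧ S1 ∪ S2 = S := by
  induction h with
  | single u =>
    obtain rfl : z = u := hz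
    exact ⟨{z}, {z}, HP.single z, HP.single z, fun x hx _ => hx, by simp⟩
  | @cons u w v S ha hS hu ih =>
    rcases hz with rfl | hz
    · exact ⟨{z}, insert z S, HP.single z, HP.cons ha hS hu, fun x hx _ => hx, by simp⟩
    · obtain ⟨S1, S2, h1, h2, h3, h4⟩ := ih hz
      refine ⟨insert u S1, S2, HP.cons ha h1 ?_, h2, ?_, ?_⟩
      · intro h; exact hu (h4 ▸ Or.inl h)
      · rintro x (rfl | hx) hx'
        · exact absurd (h4 ▸ Or.inr hx') hu
        · exact h3 x hx hx'
      · rw [Set.insert_union, h4]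

lemma exists_walk {u v : V} {S : Set V} (h : HP G u v S) :
    ∃ p : G.Walk u v, p.IsPath ∧ (∀ x, x ∈ p.support ↔ x ∈ S) ∧ p.length + 1 = S.ncard := by
  induction h with
  | single u => exact ⟨Walk.nil, by simp, by simp, by simp⟩
  | @cons u w v S ha hS hu ih =>
    obtain ⟨p, hp, hs, hl⟩ := ih
    have hf : S.Finite := by
      have : S = {x | x ∈ p.support} := by ext x; exact (hs x).symm
      rw [this]; exact p.support.finite_toSet
    refine ⟨Walk.cons ha p, ?_, ?_, ?_⟩
    · rw [Walk.cons_isPath_iff]; exact ⟨hp, fun h => hu ((hs u).1 h)⟩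
    · intro x; simp [hs]
    · rw [Walk.length_cons, hl, Set.ncard_insert_of_notMem hu hf]

lemma of_walk {u v : V} (p : G.Walk u v) (hp : p.IsPath) : HP G u v {x | x ∈ p.support} := by
  induction p with
  | nil => simpa using HP.single _
  | @cons u w v h p ih =>
    rw [Walk.cons_isPath_iff] at hp
    have := HP.cons h (ih hp.1) hp.2
    convert this using 1
    ext x; simp

lemma le_circ [Finite V] {u v : V} {S : Set V} (h : HP G u v S) (ha : G.Adj v u)
    (hc : 3 ≤ S.ncard) : S.ncard ≤ circ G := by
  obtain ⟨p, hp, hs, hl⟩ := h.exists_walk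
  have hcyc : (Walk.cons ha p).IsCycle := by
    rw [Walk.cons_isCycle_iff]
    refine ⟨hp, fun he => ?_⟩
    cases p with
    | nil => simp at he
    | @cons _ w _ h' q =>
      rw [Walk.cons_isPath_iff] at hp
      simp only [Walk.edges_cons, List.mem_cons] at he
      rcases he with he | he
      · have hw : v = w := by
          have := h'.ne
          have := ha.ne
          simp only [Sym2.eq_iff] at he
          grind
        subst hw
        have := (Walk.isPath_iff_nil.1 hp.1).eq_nil
        subst this
        simp at hl
        omega
      · exact hp.2 (Walk.snd_mem_support_of_mem_edges q he)
  unfold circ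
  apply le_csSup
  · have := Fintype.ofFinite V
    refine ⟨Fintype.card V, ?_⟩
    rintro n ⟨v, w, hw, rfl⟩
    have h1 := hw.support_nodup.length_le_card
    simpa using h1
  · exact ⟨v, Walk.cons ha p, hcyc, by simpa using hl⟩

lemma uncons {u v : V} {S : Set V} (h : HP G u v S) (huv : u ≠ v) :
    ∃ w T, G.Adj u w ∧ HP G w v T ∧ u ∉ T ∧ S = insert u T := by
  cases h with
  | single => exact absurd rfl huv
  | cons ha hS hu => exact ⟨_, _, ha, hS, hu, rfl⟩

lemma cycle_le [Finite V] {u v : V} {S T : Set V} (h : HP G u v S) (h' : HP G u v T)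
    (huv : u ≠ v) (hd : ∀ z, z ∈ S → z ∈ T → z = u ∨ z = v)
    (hc : 3 ≤ (S ∪ T).ncard) : (S ∪ T).ncard ≤ circ G := by
  obtain ⟨w, T', ha, hT, hu, rfl⟩ := h'.uncons huv
  have h1 := hT.glue h.symm (by
    intro z hz hz'
    rcases hd z hz' (Set.mem_insert_of_mem _ hz) with rfl | rfl
    · exact absurd hz hu
    · rfl)
  have e : T' ∪ S = S ∪ insert u T' := by
    have := h.left_mem
    ext z
    simp only [Set.mem_union, Set.mem_insert_iff]
    grind
  rw [e] at h1
  exact h1.le_circ ha hc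

lemma connect [Finite V] (hG : TwoConnected G) (v : V) (A B : Set V) (hA : v ∉ A) (hB : v ∉ B)
    (hA' : A.Nonempty) (hB' : B.Nonempty) :
    ∃ a b S, a ∈ A ∧ b ∈ B ∧ HP G a b S ∧ v ∉ S ∧ (∀ z, z ∈ S → z ∈ A → z = a) ∧
      (∀ z, z ∈ S → z ∈ B → z = b) := by
  classical
  obtain ⟨a0, ha0⟩ := hA'
  obtain ⟨b0, hb0⟩ := hB'
  have hex : ∃ n a b S, a ∈ A ∧ b ∈ B ∧ HP G a b S ∧ v ∉ S ∧ S.ncard = n := by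
    have hc := hG.2 v
    obtain ⟨p, hp⟩ := hc.exists_isPath ⟨a0, fun h => hA (h ▸ ha0)⟩ ⟨b0, fun h => hB (h ▸ hb0)⟩
    let f : G.induce {u | u ≠ v} →g G := (Embedding.induce _).toHom
    refine ⟨_, a0, b0, _, ha0, hb0, of_walk (p.map f) ?_, ?_, rfl⟩
    · exact hp.map (fun x y h => Subtype.ext h)
    · simp only [Set.mem_ofPred_eq, Walk.support_map, List.mem_map]
      rintro ⟨x, -, hx⟩
      exact x.2 hx
  obtain ⟨a, b, S, ha, hb, hS, hv, hn⟩ := Nat.find_spec hex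
  have hmin : ∀ a b S', a ∈ A → b ∈ B → HP G a b S' → S' ⊆ S → S' = S := by
    intro a' b' S' ha' hb' hS' hsub
    apply Set.eq_of_subset_of_ncard_le hsub
    rw [hn]
    exact Nat.find_min' hex ⟨a', b', S', ha', hb', hS', fun h => hv (hsub h), rfl⟩
  refine ⟨a, b, S, ha, hb, hS, hv, ?_, ?_⟩
  · intro z hz hzA
    obtain ⟨S1, S2, h1, h2, h3, h4⟩ := hS.split hz
    have := hmin z b S2 hzA hb h2 (h4 ▸ Set.subset_union_right)
    exact (h3 a h1.left_mem (this ▸ hS.left_mem)).symm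
  · intro z hz hzB
    obtain ⟨S1, S2, h1, h2, h3, h4⟩ := hS.split hz
    have := hmin a z S1 ha hzB h1 (h4 ▸ Set.subset_union_left)
    exact (h3 b (this ▸ hS.right_mem) h2.right_mem).symm

/-- Rerouting one of two disjoint paths. -/
lemma reroute {u v c d w z : V} {S T N : Set V} (hS : HP G u c S) (hT : HP G v d T)
    (hST : ∀ x, x ∈ S → x ∉ T) (hcd : G.Adj c d) (hN : HP G z w N) (hz : z ∈ S ∪ T)
    (hzd : d ∉ N) (hNd : ∀ x, x ∈ N → x ∈ S ∪ T → x = z) :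
    ∃ S' T', (∀ x, x ∈ S' → x ∉ T') ∧ (∀ x, x ∈ S' ∪ T' → x ∈ S ∪ T ∪ N) ∧
      ((HP G u w S' ∧ HP G v d T') ∨ (HP G u d S' ∧ HP G v w T')) := by
  have hd := hT.right_mem
  rcases hz with hz | hz
  · obtain ⟨S1, S2, h1, h2, h3, h4⟩ := hS.split hz
    have hsub : ∀ x, x ∈ S1 → x ∈ S := fun x hx => h4 ▸ Or.inl hx
    refine ⟨S1 ∪ N, T, ?_, ?_, Or.inl ⟨h1.glue hN ?_, hT⟩⟩
    · rintro x (hx | hx) hxT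
      · exact hST x (hsub x hx) hxT
      · have := hNd x hx (Or.inr hxT)
        subst this
        exact hST _ hz hxT
    · simp only [Set.mem_union]; grind
    · intro x hx hx'
      exact hNd x hx' (Or.inl (hsub x hx))
  · obtain ⟨S1, S2, h1, h2, h3, h4⟩ := hT.split hz
    have hsub : ∀ x, x ∈ S1 → x ∈ T := fun x hx => h4 ▸ Or.inl hx
    have hd1 : d ∉ S1 := by
      intro h
      have := h3 d h h2.right_mem
      subst this
      exact hzd hN.left_mem
    refine ⟨S ∪ {d}, S1 ∪ N, ?_, ?_, Or.inr ⟨hS.join hcd (HP.single d) ?_, h1.glue hN ?_⟩⟩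
    · rintro x (hx | rfl) (hx' | hx')
      · exact hST x hx (hsub x hx')
      · have := hNd x hx' (Or.inl hx)
        subst this
        exact hST _ hx hz
      · exact hd1 hx'
      · exact hzd hx'
    · simp only [Set.mem_union, Set.mem_singleton_iff]; grind
    · rintro x hx rfl; exact hST _ hx hd
    · intro x hx hx'
      exact hNd x hx' (Or.inr (hsub x hx))

end HP

/-- The set of vertices with index between `i` and `j`. -/
def segS {V : Type} (f : ℕ → V) (i j : ℕ) : Set V := {v | ∃ k, i ≤ k ∧ k ≤ j ∧ f k = v}

lemma mem_segS {V : Type} {f : ℕ → V} {i j : ℕ} {v : V} :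
    v ∈ segS f i j ↔ ∃ k, i ≤ k ∧ k ≤ j ∧ f k = v := Iff.rfl

/-- An indexed path. -/
structure IP {V : Type} (G : SimpleGraph V) (f : ℕ → V) (m : ℕ) : Prop where
  inj : ∀ i j, i ≤ m → j ≤ m → f i = f j → i = j
  adj : ∀ i, i < m → G.Adj (f i) (f (i + 1))

namespace IP

variable {V : Type} {G : SimpleGraph V} {f : ℕ → V} {m : ℕ}

lemma seg (h : IP G f m) {i j : ℕ} (hij : i ≤ j) (hj : j ≤ m) :
    HP G (f i) (f j) (segS f i j) := by
  induction j, hij using Nat.le_induction with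
  | base =>
    convert HP.single (f i)
    ext v
    simp only [mem_segS, Set.mem_singleton_iff]
    constructor
    · rintro ⟨k, h1, h2, rfl⟩
      rw [le_antisymm h2 h1]
    · rintro rfl; exact ⟨i, le_rfl, le_rfl, rfl⟩
  | succ j hij ih =>
    have := (ih (by omega)).join (h.adj j (by omega)) (HP.single _) (by
      rintro z ⟨k, h1, h2, rfl⟩ hz
      have := h.inj _ _ (by omega) hj hz
      omega)
    convert this using 1
    ext v
    simp only [mem_segS, Set.mem_union, Set.mem_singleton_iff]
    constructor
    · rintro ⟨k, h1, h2, rfl⟩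
      rcases Nat.lt_or_ge j k with h3 | h3
      · right; congr 1; omega
      · left; exact ⟨k, h1, h3, rfl⟩
    · rintro (⟨k, h1, h2, rfl⟩ | rfl)
      · exact ⟨k, h1, by omega, rfl⟩
      · exact ⟨j + 1, by omega, le_rfl, rfl⟩

lemma card_le [Finite V] (h : IP G f m) (I : Finset ℕ) (hI : ∀ k ∈ I, k ≤ m) (S : Set V)
    (hS : ∀ k ∈ I, f k ∈ S) : I.card ≤ S.ncard := by
  classical
  have h1 : (I.image f).card = I.card :=
    Finset.card_image_of_injOn fun a ha b hb hab => h.inj a b (hI a ha) (hI b hb) hab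
  rw [← h1, ← Set.ncard_coe_finset]
  apply Set.ncard_le_ncard _ (Set.toFinite S)
  intro v hv
  simp only [Finset.coe_image, Set.mem_image, Finset.mem_coe] at hv
  obtain ⟨k, hk, rfl⟩ := hv
  exact hS k hk

/-- crossing chords -/
lemma crossing [Finite V] (h : IP G f m) (hm : 2 ≤ m) (A B : Finset ℕ)
    (hA : ∀ k, k ∈ A ↔ k ≤ m ∧ G.Adj (f 0) (f k))
    (hB : ∀ k, k ∈ B ↔ k ≤ m ∧ G.Adj (f m) (f k))
    (hcr : ∃ i j, i ∈ B ∧ j ∈ A ∧ i < j) :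
    min (m + 1) (A.card + B.card) ≤ circ G := by
  classical
  have hex : ∃ n i j, i ∈ B ∧ j ∈ A ∧ i < j ∧ j = i + n := by
    obtain ⟨i, j, hi, hj, hij⟩ := hcr
    exact ⟨j - i, i, j, hi, hj, hij, by omega⟩
  obtain ⟨i, j, hi, hj, hij, hn⟩ := Nat.find_spec hex
  have hmin : ∀ i' j', i' ∈ B → j' ∈ A → i' < j' → j - i ≤ j' - i' := by
    intro i' j' h1 h2 h3
    have := Nat.find_min' hex ⟨i', j', h1, h2, h3, (by omega : j' = i' + (j' - i'))⟩
    omega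
  have h1A : 1 ∈ A := (hA 1).2 ⟨by omega, h.adj 0 (by omega)⟩
  have h1B : m - 1 ∈ B := (hB _).2 ⟨by omega, by
    have := (h.adj (m - 1) (by omega)).symm
    rwa [show m - 1 + 1 = m by omega] at this⟩
  have hjm := ((hA j).1 hj).1
  have hcyc : HP G (f 0) (f j) (segS f 0 i ∪ segS f j m) :=
    (h.seg (Nat.zero_le i) (by omega)).join ((hB i).1 hi).2.symm (h.seg hjm le_rfl).symm (by
      rintro z ⟨k, h1, h2, rfl⟩ ⟨l, h3, h4, h5⟩
      have := h.inj _ _ h4 (by omega) h5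
      omega)
  have hcard : m + 2 - (j - i) ≤ (segS f 0 i ∪ segS f j m).ncard := by
    have := h.card_le (Finset.range (i + 1) ∪ Finset.Icc j m) (by
      intro k hk; simp at hk; omega) (segS f 0 i ∪ segS f j m) (by
      intro k hk
      simp only [Finset.mem_union, Finset.mem_range, Finset.mem_Icc] at hk
      rcases hk with hk | hk
      · left; exact ⟨k, by omega, by omega, rfl⟩
      · right; exact ⟨k, by omega, by omega, rfl⟩)
    rw [Finset.card_union_of_disjoint] at this
    · simp only [Finset.card_range, Nat.card_Icc] at this
      omega
    · rw [Finset.disjoint_left]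
      intro k; simp; omega
  have h3 : 3 ≤ m + 2 - (j - i) := by
    rcases Nat.lt_or_ge 0 i with h0 | h0
    · rcases Nat.lt_or_ge j m with h1 | h1
      · omega
      · have := hmin (m - 1) j h1B hj (by omega)
        omega
    · have := hmin i 1 hi h1A (by omega)
      omega
  have hle := hcyc.le_circ ((hA j).1 hj).2.symm (by omega)
  rcases Nat.lt_or_ge (i + 1) j with hgap | hgap
  · refine (min_le_right _ _).trans (le_trans ?_ (hcard.trans hle))
    have h4 : (A ∪ B.image Nat.succ).card ≤ (Finset.Icc 1 (i + 1) ∪ Finset.Icc j m).card := by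
      apply Finset.card_le_card
      intro k hk
      simp only [Finset.mem_union, Finset.mem_image, Finset.mem_Icc] at hk ⊢
      rcases hk with hk | ⟨l, hl, rfl⟩
      · have h5 := (hA k).1 hk
        have h6 : k ≠ 0 := by
          rintro rfl
          exact h5.2.ne rfl
        by_contra hcon
        have := hmin i k hi hk (by omega)
        omega
      · have h5 := (hB l).1 hl
        have h6 : l ≠ m := by
          rintro rfl
          exact h5.2.ne rfl
        by_contra hcon
        have := hmin l j hl hj (by omega)
        omega
    rw [Finset.card_union_of_disjoint, Finset.card_union_of_disjoint,
      Finset.card_image_of_injective _ Nat.succ_injective] at h4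
    · simp only [Nat.card_Icc] at h4
      omega
    · rw [Finset.disjoint_left]
      intro k; simp; omega
    · rw [Finset.disjoint_left]
      intro k hk hk'
      simp only [Finset.mem_image] at hk'
      obtain ⟨l, hl, rfl⟩ := hk'
      have := hmin l _ hl hk (by omega)
      omega
  · refine (min_le_left _ _).trans (le_trans ?_ (hcard.trans hle))
    omega

/-- Two disjoint paths leaving the initial segment `[0,s]`. -/
def Raw (G : SimpleGraph V) (f : ℕ → V) (m s i j : ℕ) : Prop :=
  s ≤ i ∧ i < j ∧ j ≤ m ∧ ∃ p, p < s ∧ ∃ S T : Set V, (∀ x, x ∈ S → x ∉ T) ∧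
    ((HP G (f s) (f i) S ∧ HP G (f p) (f j) T) ∨ (HP G (f s) (f j) S ∧ HP G (f p) (f i) T)) ∧
    (∀ k, k ≤ s → f k ∈ S ∪ T → k = s ∨ k = p) ∧
    (∀ k, i ≤ k → k ≤ m → f k ∈ S ∪ T → k = i ∨ k = j)

lemma raw_base [Finite V] (h : IP G f m) (hG : TwoConnected G) {s : ℕ} (hs : 0 < s) (hsm : s < m) :
    ∃ j, Raw G f m s s j := by
  obtain ⟨a, b, S, ⟨p, -, hp, rfl⟩, ⟨j, hj, hjm, rfl⟩, hS, hv, h1, h2⟩ :=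
    HP.connect hG (f s) (segS f 0 (s - 1)) (segS f (s + 1) m)
    (by rintro ⟨k, h1, h2, h3⟩
        have := h.inj _ _ (by omega) (by omega) h3
        omega)
    (by rintro ⟨k, h1, h2, h3⟩
        have := h.inj _ _ (by omega) (by omega) h3
        omega) ⟨f 0, 0, by omega, by omega, rfl⟩ ⟨f m, m, by omega, by omega, rfl⟩
  refine ⟨j, le_rfl, by omega, hjm, p, by omega, {f s}, S, ?_, Or.inl ⟨HP.single _, hS⟩, ?_, ?_⟩
  · rintro x rfl; exact hv
  · rintro k hk (hk' | hk')
    · exact Or.inl (h.inj _ _ (by omega) (by omega) hk')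
    · rcases Nat.lt_or_ge k s with h3 | h3
      · exact Or.inr (h.inj _ _ (by omega) (by omega) (h1 _ hk' ⟨k, by omega, by omega, rfl⟩))
      · omega
  · rintro k hk hkm (hk' | hk')
    · exact Or.inl (h.inj _ _ (by omega) (by omega) hk')
    · rcases Nat.lt_or_ge s k with h3 | h3
      · exact Or.inr (h.inj _ _ (by omega) (by omega) (h2 _ hk' ⟨k, by omega, by omega, rfl⟩))
      · omega

lemma raw_extend (h : IP G f m) {s i j k : ℕ} (hr : Raw G f m s i j) (hik : i ≤ k) (hkj : k < j) :
    Raw G f m s k j := by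
  induction k, hik using Nat.le_induction with
  | base => exact hr
  | succ k hik ih =>
    obtain ⟨h1, h2, h3, p, hp, S, T, hST, hor, hX, hY⟩ := ih (by omega)
    have hadj := h.adj k (by omega)
    have hnot : f (k + 1) ∉ S ∪ T := by
      intro hh
      have := hY _ (by omega) (by omega) hh
      omega
    have hnS : f (k + 1) ∉ S := fun hh => hnot (Or.inl hh)
    have hnT : f (k + 1) ∉ T := fun hh => hnot (Or.inr hh)
    have key : ∀ l, l ≤ m → f l ∈ S ∪ T ∪ {f (k + 1)} → f l ∈ S ∪ T ∨ l = k + 1 := by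
      rintro l hl (hh | hh)
      · exact Or.inl hh
      · exact Or.inr (h.inj _ _ hl (by omega) hh)
    have key1 : ∀ l, l ≤ s → f l ∈ S ∪ T ∪ {f (k + 1)} → l = s ∨ l = p := by
      intro l hl hh
      rcases key l (by omega) hh with hh | hh
      · exact hX l hl hh
      · omega
    have key2 : ∀ l, k + 1 ≤ l → l ≤ m → f l ∈ S ∪ T ∪ {f (k + 1)} → l = k + 1 ∨ l = j := by
      intro l hl hlm hh
      rcases key l (by omega) hh with hh | hh
      · have := hY l (by omega) hlm hh
        omega
      · omega
    refine ⟨by omega, by omega, h3, p, hp, ?_⟩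
    rcases hor with ⟨hS, hT⟩ | ⟨hS, hT⟩
    · refine ⟨S ∪ {f (k + 1)}, T, ?_, Or.inl ⟨hS.join hadj (HP.single _) ?_, hT⟩, ?_, ?_⟩
      · rintro x (hx | rfl)
        · exact hST x hx
        · exact hnT
      · rintro x hx rfl; exact hnS hx
      · rwa [Set.union_right_comm]
      · rwa [Set.union_right_comm]
    · refine ⟨S, T ∪ {f (k + 1)}, ?_, Or.inr ⟨hS, hT.join hadj (HP.single _) ?_⟩, ?_, ?_⟩
      · rintro x hx (hx' | rfl)
        · exact hST x hx hx'
        · exact hnS hx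
      · rintro x hx rfl; exact hnT hx
      · rwa [← Set.union_assoc]
      · rwa [← Set.union_assoc]

lemma raw_step [Finite V] (h : IP G f m) (hG : TwoConnected G) {s i j : ℕ}
    (hr : Raw G f m s i j) (hjm' : j < m) : ∃ j', Raw G f m s j j' := by
  have hij := hr.2.1
  obtain ⟨h1, h2, h3, p, hp, S, T, hST, hor, hX, hY⟩ :=
    h.raw_extend hr (k := j - 1) (by omega) (by omega)
  have hadj : G.Adj (f (j - 1)) (f j) := by
    have := h.adj (j - 1) (by omega)
    rwa [show j - 1 + 1 = j by omega] at this
  have hsS : f s ∈ S := by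
    rcases hor with hh | hh
    · exact hh.1.left_mem
    · exact hh.1.left_mem
  have hpT : f p ∈ T := by
    rcases hor with hh | hh
    · exact hh.2.left_mem
    · exact hh.2.left_mem
  obtain ⟨a, b, N, ⟨haU, haj⟩, ⟨j', hj', hjm'', rfl⟩, hN, hv, hN1, hN2⟩ :=
    HP.connect hG (f j) ((S ∪ T ∪ segS f 0 s) \ {f j}) (segS f (j + 1) m)
    (by simp)
    (by rintro ⟨k, h1, h2, h3⟩
        have := h.inj _ _ (by omega) (by omega) h3
        omega)
    ⟨f s, Or.inl (Or.inl hsS), fun hh => by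
      have := h.inj _ _ (by omega) (by omega) hh
      omega⟩ ⟨f m, m, by omega, by omega, rfl⟩
  have hN1' : ∀ z, z ∈ N → z ∈ S ∪ T ∪ segS f 0 s → z = a := fun z hz hz' =>
    hN1 z hz ⟨hz', fun hh => hv (by rw [← (hh : z = f j)]; exact hz)⟩
  have hNk : ∀ k, j ≤ k → k ≤ m → f k ∈ N → k = j' := by
    intro k hk hkm hh
    rcases Nat.lt_or_ge j k with h4 | h4
    · exact h.inj _ _ hkm hjm'' (hN2 _ hh ⟨k, h4, hkm, rfl⟩)
    · obtain rfl : k = j := by omega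
      exact absurd hh hv
  refine ⟨j', by omega, by omega, hjm'', ?_⟩
  by_cases haST : a ∈ S ∪ T
  · -- landing on the two paths
    have hNd : ∀ x, x ∈ N → x ∈ S ∪ T → x = a := fun x hx hx' => hN1' x hx (Or.inl hx')
    have fin : ∀ S' T' : Set V, (∀ x, x ∈ S' ∪ T' → x ∈ S ∪ T ∪ N) →
        (∀ k, k ≤ s → f k ∈ S' ∪ T' → k = s ∨ k = p) ∧
        (∀ k, j ≤ k → k ≤ m → f k ∈ S' ∪ T' → k = j ∨ k = j') := by
      intro S' T' hsub
      constructor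
      · intro k hk hh
        rcases hsub _ hh with hh | hh
        · exact hX k hk hh
        · have := hN1' _ hh (Or.inr ⟨k, by omega, hk, rfl⟩)
          rw [← this] at haST
          exact hX k hk haST
      · intro k hk hkm hh
        rcases hsub _ hh with hh | hh
        · have := hY k (by omega) hkm hh
          omega
        · exact Or.inr (hNk k hk hkm hh)
    rcases hor with ⟨hS, hT⟩ | ⟨hS, hT⟩
    · obtain ⟨S', T', hd, hsub, hor⟩ := hS.reroute hT hST hadj hN haST hv hNd
      exact ⟨p, hp, S', T', hd, hor.symm, fin S' T' hsub⟩
    · obtain ⟨T', S', hd, hsub, hor⟩ := hT.reroute hS (fun x hx hx' => hST x hx' hx) hadj hN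
        (by rwa [Set.union_comm]) hv (by rwa [Set.union_comm])
      refine ⟨p, hp, S', T', fun x hx hx' => hd x hx' hx, ?_, fin S' T' ?_⟩
      · rcases hor with ⟨h5, h6⟩ | ⟨h5, h6⟩
        · exact Or.inl ⟨h6, h5⟩
        · exact Or.inr ⟨h6, h5⟩
      · rwa [Set.union_comm S, Set.union_comm S']
  · -- landing on the initial segment
    obtain ⟨q, -, hq, rfl⟩ : a ∈ segS f 0 s := haU.resolve_left haST
    have hqs : q ≠ s := by
      rintro rfl; exact haST (Or.inl hsS)
    have hNS : ∀ x, x ∈ S → x ∉ N := by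
      intro x hx hx'
      have := hN1' x hx' (Or.inl (Or.inl hx))
      subst this
      exact haST (Or.inl hx)
    have : ∃ S', HP G (f s) (f j) S' ∧ ∀ x, x ∈ S' → x ∈ S ∨ x = f j := by
      rcases hor with ⟨hS, hT⟩ | ⟨hS, hT⟩
      · refine ⟨S ∪ {f j}, hS.join hadj (HP.single _) ?_, ?_⟩
        · rintro x hx rfl; exact hST _ hx hT.right_mem
        · rintro x (hx | hx)
          · exact Or.inl hx
          · exact Or.inr hx
      · exact ⟨S, hS, fun x hx => Or.inl hx⟩
    obtain ⟨S', hS', hsub⟩ := this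
    refine ⟨q, by omega, S', N, ?_, Or.inl ⟨hS', hN⟩, ?_, ?_⟩
    · intro x hx hx'
      rcases hsub x hx with hh | rfl
      · exact hNS x hh hx'
      · exact hv hx'
    · rintro k hk (hh | hh)
      · rcases hsub _ hh with h4 | h4
        · rcases hX k hk (Or.inl h4) with h5 | h5
          · exact Or.inl h5
          · subst h5; exact absurd hpT (hST _ h4)
        · have := h.inj _ _ (by omega) (by omega) h4
          omega
      · exact Or.inr (h.inj _ _ (by omega) (by omega)
          (hN1' _ hh (Or.inr ⟨k, by omega, hk, rfl⟩)))
    · rintro k hk hkm (hh | hh)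
      · rcases hsub _ hh with h4 | h4
        · have := hY k (by omega) hkm (Or.inl h4)
          omega
        · exact Or.inl (h.inj _ _ (by omega) (by omega) h4)
      · exact Or.inr (hNk k hk hkm hh)

lemma raw_reach [Finite V] (h : IP G f m) (hG : TwoConnected G) {s t : ℕ} (hs : 0 < s)
    (hst : s ≤ t) (htm : t < m) : ∃ j, Raw G f m s t j := by
  have key : ∀ n i j, m - j = n → i ≤ t → Raw G f m s i j → ∃ j, Raw G f m s t j := by
    intro n
    induction n using Nat.strong_induction_on with
    | _ n ih =>
      intro i j hn hi hr
      rcases Nat.lt_or_ge t j with h1 | h1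
      · exact ⟨j, h.raw_extend hr hi h1⟩
      · obtain ⟨j', hr'⟩ := h.raw_step hG hr (by omega)
        have := hr'.2.1
        have := hr'.2.2.1
        exact ih (m - j') (by omega) j j' rfl h1 hr'
  obtain ⟨j, hr⟩ := h.raw_base hG hs (by omega)
  exact key _ s j rfl hst hr

end IP

namespace IP

variable {V : Type} {G : SimpleGraph V} {f : ℕ → V} {m : ℕ}

lemma four_cycle [Finite V] {u v c d : V} {X S Y T : Set V} (hX : HP G u v X) (hS : HP G v c S)
    (hY : HP G c d Y) (hT : HP G u d T) (hud : u ≠ d)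
    (hXS : ∀ z, z ∈ X → z ∈ S → z = v) (hSY : ∀ z, z ∈ S → z ∈ Y → z = c)
    (hXY : ∀ z, z ∈ X → z ∈ Y → z = c) (hXT : ∀ z, z ∈ X → z ∈ T → z = u)
    (hYT : ∀ z, z ∈ Y → z ∈ T → z = d) (hST : ∀ z, z ∈ S → z ∉ T)
    (hc : 3 ≤ (X ∪ Y).ncard) : (X ∪ Y).ncard ≤ circ G := by
  have h1 := (hX.glue hS hXS).glue hY (by
    rintro z (hz | hz) hz'
    · exact hXY z hz hz'
    · exact hSY z hz hz')
  have hle : (X ∪ Y).ncard ≤ (X ∪ S ∪ Y ∪ T).ncard := by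
    apply Set.ncard_le_ncard _ (Set.toFinite _)
    rintro z (hz | hz)
    · exact Or.inl (Or.inl (Or.inl hz))
    · exact Or.inl (Or.inr hz)
  refine hle.trans (h1.cycle_le hT hud ?_ (hc.trans hle))
  rintro z ((hz | hz) | hz) hz'
  · exact Or.inl (hXT z hz hz')
  · exact absurd hz' (hST z hz)
  · exact Or.inr (hYT z hz hz')

lemma noncrossing [Finite V] (h : IP G f m) (hG : TwoConnected G) (hm : 2 ≤ m) (A B : Finset ℕ)
    (hA : ∀ k, k ∈ A ↔ k ≤ m ∧ G.Adj (f 0) (f k))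
    (hB : ∀ k, k ∈ B ↔ k ≤ m ∧ G.Adj (f m) (f k))
    (hcr : ∀ i j, i ∈ B → j ∈ A → j ≤ i) :
    A.card + B.card ≤ circ G := by
  classical
  have h1A : 1 ∈ A := (hA 1).2 ⟨by omega, h.adj 0 (by omega)⟩
  have h1B : m - 1 ∈ B := (hB _).2 ⟨by omega, by
    have := (h.adj (m - 1) (by omega)).symm
    rwa [show m - 1 + 1 = m by omega] at this⟩
  obtain ⟨s, hsA, hsmax⟩ : ∃ s ∈ A, ∀ k ∈ A, k ≤ s :=
    ⟨A.max' ⟨1, h1A⟩, A.max'_mem _, fun k hk => A.le_max' k hk⟩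
  obtain ⟨t, htB, htmin⟩ : ∃ t ∈ B, ∀ k ∈ B, t ≤ k :=
    ⟨B.min' ⟨m - 1, h1B⟩, B.min'_mem _, fun k hk => B.min'_le k hk⟩
  have hst := hcr t s htB hsA
  have hs1 := hsmax 1 h1A
  have htm := htmin _ h1B
  obtain ⟨j, -, htj, hjm, p, hp, S, T, hST, hor, hXX, hYY⟩ :=
    h.raw_reach hG (s := s) (t := t) (by omega) hst (by omega)
  obtain ⟨a, haA, hpa, hamin⟩ : ∃ a ∈ A, p < a ∧ ∀ k ∈ A, p < k → a ≤ k := by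
    have hne : (A.filter (p < ·)).Nonempty := ⟨s, by simp [hsA, hp]⟩
    have := (A.filter (p < ·)).min'_mem hne
    rw [Finset.mem_filter] at this
    exact ⟨_, this.1, this.2, fun k hk hk' => Finset.min'_le _ k (by simp [hk, hk'])⟩
  obtain ⟨b, hbB, hbj, hbmax⟩ : ∃ b ∈ B, b < j ∧ ∀ k ∈ B, k < j → k ≤ b := by
    have hne : (B.filter (· < j)).Nonempty := ⟨t, by simp [htB, htj]⟩
    have := (B.filter (· < j)).max'_mem hne
    rw [Finset.mem_filter] at this
    exact ⟨_, this.1, this.2, fun k hk hk' => Finset.le_max' _ k (by simp [hk, hk'])⟩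
  have has := hsmax a haA
  have htb := htmin b hbB
  set X := segS f 0 p ∪ segS f a s with hXdef
  set Y := segS f t b ∪ segS f j m with hYdef
  have hX : HP G (f p) (f s) X :=
    (h.seg (Nat.zero_le p) (by omega)).symm.join ((hA a).1 haA).2 (h.seg has (by omega)) (by
      rintro z ⟨k, h1, h2, rfl⟩ ⟨l, h3, h4, h5⟩
      have := h.inj _ _ (by omega) (by omega) h5
      omega)
  have hY : HP G (f t) (f j) Y :=
    (h.seg htb (by omega)).join ((hB b).1 hbB).2.symm (h.seg hjm le_rfl).symm (by
      rintro z ⟨k, h1, h2, rfl⟩ ⟨l, h3, h4, h5⟩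
      have := h.inj _ _ (by omega) (by omega) h5
      omega)
  have hXm : ∀ z, z ∈ X → ∃ k, k ≤ s ∧ f k = z := by
    rintro z (⟨k, h1, h2, rfl⟩ | ⟨k, h1, h2, rfl⟩)
    · exact ⟨k, by omega, rfl⟩
    · exact ⟨k, by omega, rfl⟩
  have hYm : ∀ z, z ∈ Y → ∃ k, t ≤ k ∧ k ≤ m ∧ f k = z := by
    rintro z (⟨k, h1, h2, rfl⟩ | ⟨k, h1, h2, rfl⟩)
    · exact ⟨k, by omega, by omega, rfl⟩
    · exact ⟨k, by omega, by omega, rfl⟩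
  have hXY : ∀ z, z ∈ X → z ∈ Y → z = f t := by
    intro z hz hz'
    obtain ⟨k, h1, rfl⟩ := hXm z hz
    obtain ⟨l, h2, h3, h4⟩ := hYm _ hz'
    have := h.inj _ _ (by omega) (by omega) h4
    congr 1; omega
  have hXST : ∀ z, z ∈ X → z ∈ S ∪ T → z = f s ∨ z = f p := by
    intro z hz hz'
    obtain ⟨k, h1, rfl⟩ := hXm z hz
    rcases hXX k h1 hz' with rfl | rfl
    · exact Or.inl rfl
    · exact Or.inr rfl
  have hYST : ∀ z, z ∈ Y → z ∈ S ∪ T → z = f t ∨ z = f j := by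
    intro z hz hz'
    obtain ⟨k, h1, h2, rfl⟩ := hYm z hz
    rcases hYY k h1 h2 hz' with rfl | rfl
    · exact Or.inl rfl
    · exact Or.inr rfl
  have h0A : 0 ∉ A := fun hh => ((hA 0).1 hh).2.ne rfl
  have hmB : m ∉ B := fun hh => ((hB m).1 hh).2.ne rfl
  have hcard : (insert 0 A ∪ insert m B).card ≤ (X ∪ Y).ncard := by
    apply h.card_le
    · intro k hk
      simp only [Finset.mem_union, Finset.mem_insert] at hk
      rcases hk with (rfl | hk) | (rfl | hk)
      · omega
      · exact ((hA k).1 hk).1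
      · omega
      · exact ((hB k).1 hk).1
    · intro k hk
      simp only [Finset.mem_union, Finset.mem_insert] at hk
      rcases hk with (rfl | hk) | (rfl | hk)
      · exact Or.inl (Or.inl ⟨0, by omega, by omega, rfl⟩)
      · left
        have := hsmax k hk
        rcases Nat.lt_or_ge p k with h1 | h1
        · exact Or.inr ⟨k, hamin k hk h1, this, rfl⟩
        · exact Or.inl ⟨k, by omega, h1, rfl⟩
      · exact Or.inr (Or.inr ⟨k, by omega, by omega, rfl⟩)
      · right
        have h0 := htmin k hk
        have := ((hB k).1 hk).1
        rcases Nat.lt_or_ge k j with h1 | h1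
        · exact Or.inl ⟨k, h0, hbmax k hk h1, rfl⟩
        · exact Or.inr ⟨k, h1, this, rfl⟩
  have hI : A.card + B.card ≤ (insert 0 A ∪ insert m B).card := by
    have h1 := Finset.card_union_add_card_inter (insert 0 A) (insert m B)
    rw [Finset.card_insert_of_notMem h0A, Finset.card_insert_of_notMem hmB] at h1
    have h2 : (insert 0 A ∩ insert m B).card ≤ ({s} : Finset ℕ).card := by
      apply Finset.card_le_card
      intro k hk
      simp only [Finset.mem_inter, Finset.mem_insert, Finset.mem_singleton] at hk ⊢
      rcases hk with ⟨rfl | h3, rfl | h4⟩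
      · omega
      · have := htmin _ h4
        omega
      · have := hsmax _ h3
        omega
      · have := hsmax _ h3
        have := htmin _ h4
        omega
    rw [Finset.card_singleton] at h2
    omega
  have h3 : 3 ≤ (insert 0 A ∪ insert m B).card := by
    have : ({0, s, m} : Finset ℕ).card ≤ (insert 0 A ∪ insert m B).card := by
      apply Finset.card_le_card
      intro k hk
      simp only [Finset.mem_union, Finset.mem_insert, Finset.mem_singleton] at hk ⊢
      rcases hk with rfl | rfl | rfl
      · simp
      · simp [hsA]
      · simp
    rwa [Finset.card_eq_three.2 ⟨0, s, m, by omega, by omega, by omega, rfl⟩] at this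
  refine hI.trans (hcard.trans ?_)
  rcases hor with ⟨hS, hT⟩ | ⟨hS, hT⟩
  · have a1 := hS.left_mem
    have a2 := hS.right_mem
    have a3 := hT.left_mem
    have a4 := hT.right_mem
    refine four_cycle hX hS hY hT ?_ ?_ ?_ hXY ?_ ?_ hST (h3.trans hcard)
    · intro hh
      have := h.inj _ _ (by omega) (by omega) hh
      omega
    · intro z hz hz'
      rcases hXST z hz (Or.inl hz') with rfl | rfl
      · rfl
      · exact absurd a3 (hST _ hz')
    · intro z hz hz'
      rcases hYST z hz' (Or.inl hz) with rfl | rfl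
      · rfl
      · exact absurd a4 (hST _ hz)
    · intro z hz hz'
      rcases hXST z hz (Or.inr hz') with rfl | rfl
      · exact absurd hz' (hST _ a1)
      · rfl
    · intro z hz hz'
      rcases hYST z hz (Or.inr hz') with rfl | rfl
      · exact absurd hz' (hST _ a2)
      · rfl
  · have a1 := hS.left_mem
    have a2 := hS.right_mem
    have a3 := hT.left_mem
    have a4 := hT.right_mem
    refine four_cycle hX.symm hT hY hS ?_ ?_ ?_ hXY ?_ ?_ (fun z hz hz' => hST z hz' hz)
      (h3.trans hcard)
    · intro hh
      have := h.inj _ _ (by omega) (by omega) hh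
      omega
    · intro z hz hz'
      rcases hXST z hz (Or.inr hz') with rfl | rfl
      · exact absurd hz' (hST _ a1)
      · rfl
    · intro z hz hz'
      rcases hYST z hz' (Or.inr hz) with rfl | rfl
      · rfl
      · exact absurd hz (hST _ a2)
    · intro z hz hz'
      rcases hXST z hz (Or.inl hz') with rfl | rfl
      · rfl
      · exact absurd a3 (hST _ hz')
    · intro z hz hz'
      rcases hYST z hz (Or.inl hz') with rfl | rfl
      · exact absurd a4 (hST _ hz')
      · rfl

lemma card_nbr [Finite V] (h : IP G f m) (A : Finset ℕ) (v : V) (p : V → Prop)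
    (hp : ∀ u, p u ↔ ∃ k, k ≤ m ∧ f k = u)
    (hA : ∀ k, k ∈ A ↔ k ≤ m ∧ G.Adj v (f k)) :
    Nat.card {u : V // p u ∧ G.Adj v u} = A.card := by
  classical
  have h1 : (A.image f).card = A.card :=
    Finset.card_image_of_injOn fun a ha b hb hab =>
      h.inj a b ((hA a).1 ha).1 ((hA b).1 hb).1 hab
  rw [← h1]
  apply Nat.subtype_card
  intro u
  simp only [Finset.mem_image, hA, hp]
  constructor
  · rintro ⟨k, ⟨h1, h2⟩, rfl⟩; exact ⟨⟨k, h1, rfl⟩, h2⟩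
  · rintro ⟨⟨k, h1, rfl⟩, h2⟩; exact ⟨k, ⟨h1, h2⟩, rfl⟩

end IP

lemma two_le_circ {V : Type} [Finite V] {G : SimpleGraph V} (hG : TwoConnected G) {x y : V}
    (hxy : G.Adj x y) : 2 ≤ circ G := by
  classical
  obtain ⟨z, hzx, hzy⟩ : ∃ z, z ≠ x ∧ z ≠ y := by
    by_contra! hcon
    have := Fintype.ofFinite V
    have h1 : (Finset.univ : Finset V).card ≤ ({x, y} : Finset V).card := by
      apply Finset.card_le_card
      intro z _
      simp only [Finset.mem_insert, Finset.mem_singleton]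
      by_cases hz : z = x
      · exact Or.inl hz
      · exact Or.inr (hcon z hz)
    have h2 := hG.1
    rw [Nat.card_eq_fintype_card, ← Finset.card_univ] at h2
    have h3 := Finset.card_le_two (a := x) (b := y)
    omega
  obtain ⟨a, b, S, rfl, rfl, hS, hxS, -, -⟩ := HP.connect hG x {y} {z} hxy.ne hzx.symm
    (Set.singleton_nonempty _) (Set.singleton_nonempty _)
  obtain ⟨w, T, haw, hT, -, rfl⟩ := hS.uncons hzy.symm
  have hwx : w ≠ x := by
    rintro rfl; exact hxS (Or.inr hT.left_mem)
  obtain ⟨a', b', N, rfl, rfl, hN, hyN, -, -⟩ := HP.connect hG a {w} {x} haw.ne hxy.ne.symm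
    (Set.singleton_nonempty _) (Set.singleton_nonempty _)
  have hc := HP.cons haw hN hyN
  have h3 : 3 ≤ (insert a N).ncard := by
    rw [Set.ncard_insert_of_notMem hyN (Set.toFinite _)]
    have : ({a', b'} : Set V).ncard ≤ N.ncard := by
      apply Set.ncard_le_ncard _ (Set.toFinite _)
      rintro z (rfl | rfl)
      · exact hN.left_mem
      · exact hN.right_mem
    rw [Set.ncard_pair hwx] at this
    omega
  have := hc.le_circ hxy h3
  omega

theorem stmt11 (V : Type) [Finite V] (G : SimpleGraph V) (hconn : TwoConnected G)
    (x y : V) (m : ℕ) (P : G.Walk x y) (hP : P.IsPath) (hm : P.length = m) :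
    min (m + 1) (Nat.card {u : V // u ∈ P.support ∧ G.Adj x u} +
      Nat.card {u : V // u ∈ P.support ∧ G.Adj y u}) ≤ circ G := by
  classical
  subst hm
  have h : IP G P.getVert P.length :=
    ⟨fun i j hi hj hij => hP.getVert_injOn hi hj hij, fun i hi => P.adj_getVert_succ hi⟩
  have hsup : ∀ u, u ∈ P.support ↔ ∃ k, k ≤ P.length ∧ P.getVert k = u := by
    intro u
    rw [Walk.mem_support_iff_exists_getVert]
    constructor
    · rintro ⟨k, h1, h2⟩; exact ⟨k, h2, h1⟩
    · rintro ⟨k, h1, h2⟩; exact ⟨k, h2, h1⟩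
  have h0 : P.getVert 0 = x := P.getVert_zero
  have hl : P.getVert P.length = y := P.getVert_length
  rcases Nat.lt_or_ge P.length 2 with hm | hm
  · rcases Nat.eq_zero_or_pos P.length with hz | hz
    · have hxy : x = y := Walk.eq_of_length_eq_zero hz
      have hemp : ∀ v, v = x → Nat.card {u : V // u ∈ P.support ∧ G.Adj v u} = 0 := by
        rintro v rfl
        have : IsEmpty {u : V // u ∈ P.support ∧ G.Adj v u} := by
          constructor
          rintro ⟨u, hu, hu'⟩
          obtain ⟨k, hk, rfl⟩ := (hsup u).1 hu
          obtain rfl : k = 0 := by omega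
          rw [h0] at hu'
          exact hu'.ne rfl
        exact Nat.card_of_isEmpty
      rw [hemp x rfl, hemp y hxy.symm]
      simp
    · have hadj : G.Adj x y := Walk.adj_of_length_eq_one (p := P) (by omega)
      have := two_le_circ hconn hadj
      exact (min_le_left _ _).trans (by omega)
  · let A := (Finset.range (P.length + 1)).filter fun k => G.Adj x (P.getVert k)
    let B := (Finset.range (P.length + 1)).filter fun k => G.Adj y (P.getVert k)
    have hA : ∀ k, k ∈ A ↔ k ≤ P.length ∧ G.Adj x (P.getVert k) := by
      intro k; simp [A, Nat.lt_succ_iff]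
    have hB : ∀ k, k ∈ B ↔ k ≤ P.length ∧ G.Adj y (P.getVert k) := by
      intro k; simp [B, Nat.lt_succ_iff]
    rw [h.card_nbr A x (· ∈ P.support) hsup hA, h.card_nbr B y (· ∈ P.support) hsup hB]
    by_cases hcr : ∃ i j, i ∈ B ∧ j ∈ A ∧ i < j
    · exact h.crossing hm A B (by rwa [h0]) (by rwa [hl]) hcr
    · push Not at hcr
      exact (min_le_right _ _).trans (h.noncrossing hconn hm A B (by rwa [h0]) (by rwa [hl]) hcr)
end
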